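/- Let A = kQ/I be a (locally) gentle algebra and v ∈ Q0. Then grExt^i_A(S(v), A) ≠ 0 if and only if one of the following holds: (1) i = 0 and there is at least one finite maximal path of A with target v; (2) i = 1 and there are two arrows with source v; (3) i > 0 and there is a right maximal forbidden path of length i with source v. -/

import Mathlib

/- Common framework for (locally) gentle algebras -/

noncomputable section
open scoped BigOperators
open CategoryTheory

namespace LocGentle

/-- A finite connected quiver with at least one vertex and one arrow. -/
structure Quiv where
  V : Type
  Arr : Type
  [fintypeV : Fintype V]
  [fintypeA : Fintype Arr]
  [decEqV : DecidableEq V]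
  [decEqA : DecidableEq Arr]
  src : Arr → V
  tgt : Arr → V
  [nonemptyV : Nonempty V]
  [nonemptyA : Nonempty Arr]
  connected : (SimpleGraph.fromRel (fun v w => ∃ a, src a = v ∧ tgt a = w)).Connected

attribute [instance] Quiv.fintypeV Quiv.fintypeA Quiv.decEqV Quiv.decEqA
  Quiv.nonemptyV Quiv.nonemptyA

variable (Q : Quiv)

/-- in-degree of a vertex -/
def indeg (v : Q.V) : ℕ := (Finset.univ.filter (fun a => Q.tgt a = v)).card

/-- out-degree of a vertex -/
def outdeg (v : Q.V) : ℕ := (Finset.univ.filter (fun a => Q.src a = v)).card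

/-- a list of arrows is composable (forms a path) -/
def Composable (l : List Q.Arr) : Prop := l.Chain' (fun a b => Q.tgt a = Q.src b)

variable {Q}

/-- source vertex of a nonempty word -/
def wSrc? (l : List Q.Arr) : Option Q.V := l.head?.map Q.src

/-- target vertex of a nonempty word -/
def wTgt? (l : List Q.Arr) : Option Q.V := l.getLast?.map Q.tgt

/-- target of a word, with a default value (used for stationary paths) -/
def wTgtD (l : List Q.Arr) (v : Q.V) : Q.V := (l.getLast?.map Q.tgt).getD v

/-- last arrow of a word, with a (junk) default -/
def wLast (l : List Q.Arr) : Q.Arr := l.getLast?.getD (Classical.arbitrary _)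

variable (rel : Q.Arr → Q.Arr → Prop)

/-- A word is allowed (is a basis path of `A = kQ/I`) if consecutive arrows are
composable and no consecutive pair lies in the relation set generating `I`. -/
def AllowedWord (l : List Q.Arr) : Prop :=
  l.Chain' (fun a b => Q.tgt a = Q.src b ∧ ¬ rel a b)

/-- right maximal paths (of positive length) -/
def RightMaxWord (l : List Q.Arr) : Prop :=
  l ≠ [] ∧ AllowedWord rel l ∧ ∀ a : Q.Arr, ¬ AllowedWord rel (l ++ [a])

/-- left maximal paths (of positive length) -/
def LeftMaxWord (l : List Q.Arr) : Prop :=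
  l ≠ [] ∧ AllowedWord rel l ∧ ∀ a : Q.Arr, ¬ AllowedWord rel (a :: l)

/-- finite maximal paths -/
def FiniteMaxWord (l : List Q.Arr) : Prop := RightMaxWord rel l ∧ LeftMaxWord rel l

/-- a word is primitive if it is not a proper power -/
def PrimitiveWord (l : List Q.Arr) : Prop :=
  ∀ (l' : List Q.Arr) (n : ℕ), 2 ≤ n → l ≠ (List.replicate n l').flatten

/-- a primitive cycle `c` with `c² ∉ I`; these represent the infinite maximal paths `c^∞`. -/
def PrimCycleSq (c : List Q.Arr) : Prop :=
  c ≠ [] ∧ AllowedWord rel (c ++ c) ∧ wTgt? c = wSrc? c ∧ PrimitiveWord c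

/-- the maximal path `γ_α` containing `α` is infinite -/
def InfThrough (a : Q.Arr) : Prop := ∃ c, PrimCycleSq rel c ∧ a ∈ c

/-- the maximal path `γ_α` containing `α` is finite -/
def FinThrough (a : Q.Arr) : Prop := ∃ l, FiniteMaxWord rel l ∧ a ∈ l

/-- the rotation of the cycle `c` starting at the arrow `a`; when `a ∈ c` and `c` has no
duplicates this is the primitive cycle `γ_r(a)`. -/
def rotTo (c : List Q.Arr) (a : Q.Arr) : List Q.Arr :=
  c.dropWhile (fun b => b != a) ++ c.takeWhile (fun b => b != a)

/-- the relation set of the Koszul dual `A#`; its allowed words are the forbidden paths of `A`. -/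
def dualRel : Q.Arr → Q.Arr → Prop := fun a b => Q.tgt a = Q.src b ∧ ¬ rel a b

/-- a forbidden path of `A`, i.e. a path of the Koszul dual `A#` -/
def ForbiddenWord (l : List Q.Arr) : Prop := AllowedWord (dualRel rel) l

variable (Q)

/-- The defining conditions (i)-(iv) of a (locally) gentle algebra, in terms of the set of
length-two relations generating the ideal `I`: an algebra satisfying them is gentle if it
is finite dimensional and locally gentle otherwise. -/
structure IsGentleRel : Prop where
  indeg_le : ∀ v : Q.V, indeg Q v ≤ 2
  outdeg_le : ∀ v : Q.V, outdeg Q v ≤ 2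
  rel_comp : ∀ a b : Q.Arr, rel a b → Q.tgt a = Q.src b
  cond_ii : ∀ a b b' : Q.Arr, b ≠ b' → Q.tgt b = Q.src a → Q.tgt b' = Q.src a →
    Xor' (rel b a) (rel b' a)
  cond_iii : ∀ a b b' : Q.Arr, b ≠ b' → Q.tgt a = Q.src b → Q.tgt a = Q.src b' →
    Xor' (rel a b) (rel a b')

/-- `Q` is (as a quiver) the extended Dynkin quiver `Ã_n` (for `n = |Q₀| - 1`):
every vertex has in-degree and out-degree one. -/
def IsAtilde : Prop := ∀ v : Q.V, indeg Q v = 1 ∧ outdeg Q v = 1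

/-- paths of `Q`, including the stationary paths (`w = []`) at each vertex -/
structure Pth where
  s : Q.V
  w : List Q.Arr
  hs : ∀ a ∈ w.head?, Q.src a = s
  hc : Composable Q w

variable {Q}

/-- target of a path -/
def Pth.t (p : Pth Q) : Q.V := wTgtD p.w p.s

/-- length of a path -/
def Pth.len (p : Pth Q) : ℕ := p.w.length

/-- a basis path of `A = kQ/I` -/
def Pth.Allowed (p : Pth Q) : Prop := AllowedWord rel p.w

end LocGentle
namespace LocGentle

variable (k : Type) [Field k] (Q : Quiv) (rel : Q.Arr → Q.Arr → Prop)

/-- The defining relations presenting `A = kQ/I` as a quotient of the free algebra on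
the stationary paths (vertices) and arrows: the path algebra relations together with
the relations `αβ = 0` for the length-two paths `αβ` generating `I`. -/
inductive GARel : FreeAlgebra k (Q.V ⊕ Q.Arr) → FreeAlgebra k (Q.V ⊕ Q.Arr) → Prop
  | idem (v : Q.V) : GARel (FreeAlgebra.ι k (Sum.inl v) * FreeAlgebra.ι k (Sum.inl v))
      (FreeAlgebra.ι k (Sum.inl v))
  | orth (v w : Q.V) : v ≠ w → GARel (FreeAlgebra.ι k (Sum.inl v) * FreeAlgebra.ι k (Sum.inl w)) 0
  | unit : GARel (∑ v : Q.V, FreeAlgebra.ι k (Sum.inl v)) 1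
  | src_mul (a : Q.Arr) : GARel (FreeAlgebra.ι k (Sum.inl (Q.src a)) * FreeAlgebra.ι k (Sum.inr a))
      (FreeAlgebra.ι k (Sum.inr a))
  | mul_tgt (a : Q.Arr) : GARel (FreeAlgebra.ι k (Sum.inr a) * FreeAlgebra.ι k (Sum.inl (Q.tgt a)))
      (FreeAlgebra.ι k (Sum.inr a))
  | src_zero (v : Q.V) (a : Q.Arr) : v ≠ Q.src a →
      GARel (FreeAlgebra.ι k (Sum.inl v) * FreeAlgebra.ι k (Sum.inr a)) 0
  | tgt_zero (v : Q.V) (a : Q.Arr) : v ≠ Q.tgt a →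
      GARel (FreeAlgebra.ι k (Sum.inr a) * FreeAlgebra.ι k (Sum.inl v)) 0
  | rel_zero (a b : Q.Arr) : rel a b →
      GARel (FreeAlgebra.ι k (Sum.inr a) * FreeAlgebra.ι k (Sum.inr b)) 0

/-- The (locally) gentle algebra `A = kQ/I`. -/
abbrev GA := RingQuot (GARel k Q rel)

/-- the image in `A` of the stationary path at `v` -/
def vtx (v : Q.V) : GA k Q rel := RingQuot.mkAlgHom k _ (FreeAlgebra.ι k (Sum.inl v))

/-- the image in `A` of the arrow `a` -/
def arr (a : Q.Arr) : GA k Q rel := RingQuot.mkAlgHom k _ (FreeAlgebra.ι k (Sum.inr a))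

/-- the image in `A` of the word `l` (the product of its arrows) -/
def wordEl (l : List Q.Arr) : GA k Q rel := (l.map (arr k Q rel)).prod

variable {Q}

/-- the image in `A` of a path (a stationary path maps to the corresponding idempotent) -/
def Pth.el (p : Pth Q) : GA k Q rel := vtx k Q rel p.s * wordEl k Q rel p.w

variable (Q)

/-- the `n`-th graded component `A_n` of `A`, spanned by the images of paths of length `n` -/
def deg (n : ℕ) : Submodule k (GA k Q rel) :=
  Submodule.span k {x | ∃ p : Pth Q, p.Allowed rel ∧ p.len = n ∧ x = p.el k rel}

/-- the augmentation ideal `A₊` (as a `k`-submodule), spanned by paths of positive length -/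
def degPlus : Submodule k (GA k Q rel) :=
  Submodule.span k {x | ∃ p : Pth Q, p.Allowed rel ∧ 1 ≤ p.len ∧ x = p.el k rel}

/-- the Hilbert series of `A` (with integer coefficients) -/
def hilb : PowerSeries ℤ :=
  PowerSeries.mk fun n => (Module.finrank k (deg k Q rel n) : ℤ)

/-- the Hilbert series of `A` (with rational coefficients) -/
def hilbQ : PowerSeries ℚ :=
  PowerSeries.mk fun n => (Module.finrank k (deg k Q rel n) : ℚ)

/-- the number `k_n` of finite maximal paths of length at least `n` -/
def numFMP (n : ℕ) : ℕ := {l : List Q.Arr | FiniteMaxWord rel l ∧ n ≤ l.length}.ncard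

/-- the Gelfand-Kirillov dimension of `A`:
`limsup_n log (dim_k A_{≤ n}) / log n`. -/
def GKdim : ℝ :=
  Filter.limsup (fun n : ℕ =>
      Real.log (Module.finrank k ↥(⨆ i ∈ Finset.range (n + 1), deg k Q rel i)) / Real.log n)
    Filter.atTop

/-- the central element `m_γ` attached to the infinite maximal path `γ = c^∞`:
the sum over the arrows `α` of `c` of the primitive cycle `γ_r(α)` starting at `α`. -/
def mEl (c : List Q.Arr) : GA k Q rel := (c.map fun a => wordEl k Q rel (rotTo c a)).sum

/-- evaluation of a polynomial at `x ∈ A`; `polyEval k Q rel p x` is `p(x)`. -/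
def polyEval (p : Polynomial k) (x : GA k Q rel) : GA k Q rel :=
  Polynomial.eval₂ (algebraMap k (GA k Q rel)) x p

end LocGentle
namespace LocGentle

variable (k : Type) [Field k] (Q : Quiv) (rel : Q.Arr → Q.Arr → Prop)

/-! ### Two-sided ideals and primes -/

/-- a prime (two-sided) ideal -/
def IsPrimeTI (P : TwoSidedIdeal (GA k Q rel)) : Prop :=
  P ≠ ⊤ ∧ ∀ x y : GA k Q rel, (∀ a : GA k Q rel, x * a * y ∈ P) → x ∈ P ∨ y ∈ P

/-- the maximal ideal `𝔪_v` of `A` which does not contain `ε_v`: it is generated by the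
stationary paths at the other vertices together with all loops at `v`. -/
def mIdeal (v : Q.V) : TwoSidedIdeal (GA k Q rel) :=
  TwoSidedIdeal.span
    ({x | ∃ w : Q.V, w ≠ v ∧ x = vtx k Q rel w} ∪
     {x | ∃ a : Q.Arr, Q.src a = v ∧ Q.tgt a = v ∧ x = arr k Q rel a})

/-- the ideal `J_γ` corresponding to the infinite maximal path `γ = c^∞`, generated by
all arrows lying on `γ` -/
def Jgamma (c : List Q.Arr) : TwoSidedIdeal (GA k Q rel) :=
  TwoSidedIdeal.span {x | ∃ a ∈ c, x = arr k Q rel a}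

/-- the left annihilator of `J_γ` -/
def annJ (c : List Q.Arr) : Set (GA k Q rel) :=
  {x | ∀ y ∈ Jgamma k Q rel c, x * y = 0}

/-! ### The simple modules `S(v)`, and `Ext` groups -/

/-- the algebra map `A → k` corresponding to the vertex `v` (projection onto the
coefficient of `ε_v`) -/
def vtxHomAux (v : Q.V) : FreeAlgebra k (Q.V ⊕ Q.Arr) →ₐ[k] k :=
  FreeAlgebra.lift k (Sum.elim (fun w => if w = v then (1 : k) else 0) (fun _ => 0))

theorem vtxHomAux_rel (v : Q.V) : ∀ ⦃x y⦄, GARel k Q rel x y →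
    vtxHomAux k Q v x = vtxHomAux k Q v y := by
  intro x y h
  cases h with
  | idem w =>
      simp only [vtxHomAux, map_mul, FreeAlgebra.lift_ι_apply, Sum.elim_inl]
      split_ifs <;> simp
  | orth w w' hne =>
      simp only [vtxHomAux, map_mul, FreeAlgebra.lift_ι_apply, Sum.elim_inl, map_zero]
      split_ifs with h1 h2 <;> first | (exact absurd (h1.trans h2.symm) hne) | simp
  | unit =>
      simp only [vtxHomAux, map_sum, FreeAlgebra.lift_ι_apply, Sum.elim_inl, map_one]
      simp [Finset.sum_ite_eq' Finset.univ v (fun _ => (1:k))]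
  | src_mul a =>
      simp [vtxHomAux, map_mul, FreeAlgebra.lift_ι_apply]
  | mul_tgt a =>
      simp [vtxHomAux, map_mul, FreeAlgebra.lift_ι_apply]
  | src_zero w a hw =>
      simp [vtxHomAux, map_mul, FreeAlgebra.lift_ι_apply]
  | tgt_zero w a hw =>
      simp [vtxHomAux, map_mul, FreeAlgebra.lift_ι_apply]
  | rel_zero a b hab =>
      simp [vtxHomAux, map_mul, FreeAlgebra.lift_ι_apply]

/-- the ring map `A → k` corresponding to the vertex `v` -/
def vtxHom (v : Q.V) : GA k Q rel →+* k :=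
  RingQuot.lift ⟨(vtxHomAux k Q v).toRingHom, fun _ _ h => vtxHomAux_rel k Q rel v h⟩

/-- the ring map `A → k^{Q₀}` with kernel `A₊` -/
def SHom : GA k Q rel →+* (Q.V → k) := Pi.ringHom fun v => vtxHom k Q rel v

/-- the graded simple right `A`-module `S(v)` at the vertex `v` -/
def SvModR (v : Q.V) : ModuleCat (GA k Q rel)ᵐᵒᵖ :=
  @ModuleCat.of _ _ k _
    (Module.compHom k ((vtxHom k Q rel v).fromOpposite (fun _ _ => mul_comm _ _)))

/-- the graded simple left `A`-module `S(v)` at the vertex `v` -/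
def SvModL (v : Q.V) : ModuleCat (GA k Q rel) :=
  @ModuleCat.of _ _ k _ (Module.compHom k (vtxHom k Q rel v))

/-- `S = A/A₊ ≅ ⊕_v S(v)` as a right `A`-module -/
def SModR : ModuleCat (GA k Q rel)ᵐᵒᵖ :=
  @ModuleCat.of _ _ (Q.V → k) _
    (Module.compHom _ ((SHom k Q rel).fromOpposite (fun _ _ => mul_comm _ _)))

/-- `S = A/A₊` as a left `A`-module -/
def SModL : ModuleCat (GA k Q rel) :=
  @ModuleCat.of _ _ (Q.V → k) _ (Module.compHom _ (SHom k Q rel))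

/-- `A` as a right module over itself -/
def AModR : ModuleCat (GA k Q rel)ᵐᵒᵖ := ModuleCat.of _ (GA k Q rel)

/-- `A` as a left module over itself -/
def AModL : ModuleCat (GA k Q rel) := ModuleCat.of _ (GA k Q rel)

/-- nonvanishing of `Ext^i(M, N)` for modules over a ring `R` -/
def extNZ {R : Type} [Ring R] (i : ℕ) (M N : ModuleCat R) : Prop :=
  ¬ Subsingleton (((Ext ℤ (ModuleCat R) i).obj (Opposite.op M)).obj N)

/-- nonvanishing of `Ext^i_A(S(v), A)` in right `A`-modules.  (For the Noetherian graded
algebra `A` with the finitely generated modules `S(v)` and `A` this agrees with the graded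
`Ext`-group, summed over all shifts, used in the paper.) -/
def extSvNZ (i : ℕ) (v : Q.V) : Prop := extNZ i (SvModR k Q rel v) (AModR k Q rel)

/-- nonvanishing of `Ext^i_A(S, A)` in right `A`-modules -/
def extSNZ (i : ℕ) : Prop := extNZ i (SModR k Q rel) (AModR k Q rel)

/-- the depth of `A`: `min { i : Ext^i_A(S, A) ≠ 0 }` -/
def depth : ℕ∞ := sInf {n : ℕ∞ | ∃ i : ℕ, n = i ∧ extSNZ k Q rel i}

/-- the right self-injective dimension of `A`:
`sup { i : Ext^i(M, A) ≠ 0 for some right module M }` -/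
def rInjDim : ℕ∞ :=
  sSup {n : ℕ∞ | ∃ (i : ℕ) (M : ModuleCat.{0} (GA k Q rel)ᵐᵒᵖ), n = i ∧ extNZ i M (AModR k Q rel)}

/-- the left self-injective dimension of `A` -/
def lInjDim : ℕ∞ :=
  sSup {n : ℕ∞ | ∃ (i : ℕ) (M : ModuleCat.{0} (GA k Q rel)), n = i ∧ extNZ i M (AModL k Q rel)}

/-- the right global dimension of `A`: `sup { i : Ext^i(M, N) ≠ 0 }` over right modules -/
def rGlDim : ℕ∞ :=
  sSup {n : ℕ∞ | ∃ (i : ℕ) (M N : ModuleCat.{0} (GA k Q rel)ᵐᵒᵖ), n = i ∧ extNZ i M N}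

/-- the left global dimension of `A` -/
def lGlDim : ℕ∞ :=
  sSup {n : ℕ∞ | ∃ (i : ℕ) (M N : ModuleCat.{0} (GA k Q rel)), n = i ∧ extNZ i M N}

end LocGentle
namespace LocGentle

section Resolution

variable {R : Type} [Ring R] {M : ModuleCat.{0} R} (X : ℕ → ModuleCat.{0} R)
  (d : ∀ n, X (n + 1) ⟶ X n)

/-- A projective resolution in a module category, built from an explicit exact sequence. -/
def resolutionOfExact (hd : ∀ n, d (n + 1) ≫ d n = 0) (ε : X 0 ⟶ M)
    (hε : d 0 ≫ ε = 0)
    [∀ n, Projective (X n)] (hsurj : Function.Surjective ε)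
    (hex₀ : ∀ x, ε x = 0 → ∃ y, d 0 y = x)
    (hex : ∀ n x, d n x = 0 → ∃ y, d (n + 1) y = x) : ProjectiveResolution M where
  complex := ChainComplex.of X d hd
  projective n := by dsimp [ChainComplex.of]; infer_instance
  π := (ChainComplex.toSingle₀Equiv _ _).symm ⟨ε, by
    rw [← hε]
    exact congrArg (· ≫ ε) (ChainComplex.of_d X d 0)⟩
  quasiIso := ⟨fun n => by
    cases n with
    | zero =>
      rw [ChainComplex.quasiIsoAt₀_iff, ShortComplex.quasiIso_iff_of_zeros' _ rfl rfl rfl]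
      constructor
      · rw [ShortComplex.moduleCat_exact_iff]
        intro x hx
        obtain ⟨y, hy⟩ := hex₀ x hx
        exact ⟨y, (congrArg (fun f : X 1 ⟶ X 0 => f y) (ChainComplex.of_d X d 0)).trans hy⟩
      · exact (ModuleCat.epi_iff_surjective _).2 hsurj
    | succ n =>
      rw [quasiIsoAt_iff_exactAt' (hL := ChainComplex.exactAt_succ_single_obj ..),
        HomologicalComplex.exactAt_iff' _ (n + 2) (n + 1) n (by simp) (by simp),
        ShortComplex.moduleCat_exact_iff]
      intro x hx
      obtain ⟨y, hy⟩ := hex n x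
        ((congrArg (fun f : X (n + 1) ⟶ X n => f x) (ChainComplex.of_d X d n)).symm.trans hx)
      exact ⟨y, (congrArg (fun f : X (n + 2) ⟶ X (n + 1) => f y)
        (ChainComplex.of_d X d (n + 1))).trans hy⟩⟩

theorem extNZ_iff_not_exactAt {M N : ModuleCat.{0} R} (P : ProjectiveResolution M) (i : ℕ) :
    extNZ i M N ↔ ¬ (P.complex.linearYonedaObj ℤ N).ExactAt i := by
  rw [extNZ, HomologicalComplex.exactAt_iff_isZero_homology,
    ← Iso.isZero_iff (P.isoExt (R := ℤ) i N), ModuleCat.isZero_iff_subsingleton]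

theorem extNZ_zero_iff {M N : ModuleCat.{0} R} (P : ProjectiveResolution M) :
    extNZ 0 M N ↔ ∃ φ : P.complex.X 0 ⟶ N, P.complex.d 1 0 ≫ φ = 0 ∧ φ ≠ 0 := by
  rw [extNZ_iff_not_exactAt P,
    HomologicalComplex.exactAt_iff' _ 0 0 1 (by simp) (by simp),
    ShortComplex.moduleCat_exact_iff]
  push Not
  constructor
  · rintro ⟨φ, h1, h2⟩
    exact ⟨φ, h1, fun h => h2 0 (by rw [map_zero]; exact h.symm)⟩
  · rintro ⟨φ, h1, h2⟩
    refine ⟨φ, h1, fun y h => h2 ?_⟩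
    have h0 : ((P.complex.linearYonedaObj ℤ N).sc' 0 0 1).f = 0 :=
      (P.complex.linearYonedaObj ℤ N).shape 0 0 (by simp)
    rw [h0] at h
    exact h.symm

theorem extNZ_succ_iff {M N : ModuleCat.{0} R} (P : ProjectiveResolution M) (n : ℕ) :
    extNZ (n + 1) M N ↔ ∃ φ : P.complex.X (n + 1) ⟶ N, P.complex.d (n + 2) (n + 1) ≫ φ = 0 ∧
      ∀ ψ : P.complex.X n ⟶ N, P.complex.d (n + 1) n ≫ ψ ≠ φ := by
  rw [extNZ_iff_not_exactAt P,
    HomologicalComplex.exactAt_iff' _ n (n + 1) (n + 2) (by simp) (by simp),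
    ShortComplex.moduleCat_exact_iff]
  push Not
  rfl

theorem extNZ_zero_iff_of_exact
    (hd : ∀ n, d (n + 1) ≫ d n = 0) (ε : X 0 ⟶ M) (hε : d 0 ≫ ε = 0)
    [∀ n, Projective (X n)] (hsurj : Function.Surjective ε)
    (hex₀ : ∀ x, ε x = 0 → ∃ y, d 0 y = x)
    (hex : ∀ n x, d n x = 0 → ∃ y, d (n + 1) y = x) (N : ModuleCat.{0} R) :
    extNZ 0 M N ↔ ∃ φ : X 0 ⟶ N, d 0 ≫ φ = 0 ∧ φ ≠ 0 := by
  rw [extNZ_zero_iff (resolutionOfExact X d hd ε hε hsurj hex₀ hex)]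
  change (∃ φ : X 0 ⟶ N, (ChainComplex.of X d hd).d 1 0 ≫ φ = 0 ∧ φ ≠ 0) ↔ _
  have h : (ChainComplex.of X d hd).d 1 0 = d 0 := ChainComplex.of_d X d 0
  exact iff_of_eq (congrArg (fun f : X 1 ⟶ X 0 => ∃ φ : X 0 ⟶ N, f ≫ φ = 0 ∧ φ ≠ 0) h)

theorem extNZ_succ_iff_of_exact
    (hd : ∀ n, d (n + 1) ≫ d n = 0) (ε : X 0 ⟶ M) (hε : d 0 ≫ ε = 0)
    [∀ n, Projective (X n)] (hsurj : Function.Surjective ε)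
    (hex₀ : ∀ x, ε x = 0 → ∃ y, d 0 y = x)
    (hex : ∀ n x, d n x = 0 → ∃ y, d (n + 1) y = x) (N : ModuleCat.{0} R) (n : ℕ) :
    extNZ (n + 1) M N ↔
      ∃ φ : X (n + 1) ⟶ N, d (n + 1) ≫ φ = 0 ∧ ∀ ψ : X n ⟶ N, d n ≫ ψ ≠ φ := by
  rw [extNZ_succ_iff (resolutionOfExact X d hd ε hε hsurj hex₀ hex)]
  have h₁ : (ChainComplex.of X d hd).d (n + 1) n = d n := ChainComplex.of_d X d n
  have h₂ : (ChainComplex.of X d hd).d (n + 2) (n + 1) = d (n + 1) := ChainComplex.of_d X d (n + 1)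
  exact iff_of_eq (congrArg₂ (fun (f : X (n + 1) ⟶ X n) (g : X (n + 2) ⟶ X (n + 1)) =>
    ∃ φ : X (n + 1) ⟶ N, g ≫ φ = 0 ∧ ∀ ψ : X n ⟶ N, f ≫ ψ ≠ φ) h₁ h₂)

end Resolution

section PathBasis

variable {Q : Quiv} {rel : Q.Arr → Q.Arr → Prop}

theorem allowedWord_nil : AllowedWord rel [] := List.IsChain.nil

theorem allowedWord_cons {a : Q.Arr} {l : List Q.Arr} :
    AllowedWord rel (a :: l) ↔
      (∀ b ∈ l.head?, Q.tgt a = Q.src b ∧ ¬ rel a b) ∧ AllowedWord rel l :=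
  List.isChain_cons

variable (rel) in
/-- A vertex together with a word is a basis path if the word is allowed and starts there. -/
def IsBasisPath (p : Q.V × List Q.Arr) : Prop :=
  (∀ a ∈ p.2.head?, Q.src a = p.1) ∧ AllowedWord rel p.2

theorem isBasisPath_nil (v : Q.V) : IsBasisPath rel (v, []) := by
  simp [IsBasisPath, allowedWord_nil]

theorem isBasisPath_cons {v : Q.V} {a : Q.Arr} {l : List Q.Arr} :
    IsBasisPath rel (v, a :: l) ↔
      v = Q.src a ∧ IsBasisPath rel (Q.tgt a, l) ∧ ∀ b ∈ l.head?, ¬ rel a b := by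
  simp only [IsBasisPath, allowedWord_cons, List.head?_cons, Option.mem_def]
  constructor
  · rintro ⟨h1, h2, h3⟩
    exact ⟨(h1 a rfl).symm, ⟨fun b hb => (h2 b hb).1.symm, h3⟩, fun b hb => (h2 b hb).2⟩
  · rintro ⟨rfl, ⟨h2, h3⟩, h4⟩
    exact ⟨fun b hb => by cases hb; rfl, fun b hb => ⟨(h2 b hb).symm, h4 b hb⟩, h3⟩

theorem wTgtD_nil (v : Q.V) : wTgtD [] v = v := rfl

theorem wTgtD_cons (v : Q.V) (a : Q.Arr) (l : List Q.Arr) :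
    wTgtD (a :: l) v = wTgtD l (Q.tgt a) := by
  cases l with
  | nil => rfl
  | cons b l =>
    simp only [wTgtD, List.getLast?_cons, Option.map_some,
      Option.getD_some]

theorem wTgtD_concat (v : Q.V) (a : Q.Arr) (l : List Q.Arr) :
    wTgtD (l ++ [a]) v = Q.tgt a := by
  simp [wTgtD]

theorem isBasisPath_concat {v : Q.V} {a : Q.Arr} {l : List Q.Arr} :
    IsBasisPath rel (v, l ++ [a]) ↔
      IsBasisPath rel (v, l) ∧ wTgtD l v = Q.src a ∧ ∀ b ∈ l.getLast?, ¬ rel b a := by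
  induction l generalizing v with
  | nil => simp [isBasisPath_cons, isBasisPath_nil, wTgtD_nil]
  | cons c l ih =>
    rw [List.cons_append, isBasisPath_cons, isBasisPath_cons, ih, wTgtD_cons]
    cases l with
    | nil => simp [wTgtD_nil, isBasisPath_nil]
    | cons d l =>
      simp only [List.cons_append, List.head?_cons, List.getLast?_cons_cons]
      tauto

end PathBasis

section Coordinates

variable {k : Type} [Field k] {Q : Quiv} {rel : Q.Arr → Q.Arr → Prop}

theorem vtx_mul_self (v : Q.V) : vtx k Q rel v * vtx k Q rel v = vtx k Q rel v := by
  rw [vtx, ← map_mul]; exact RingQuot.mkAlgHom_rel k (GARel.idem v)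

theorem vtx_mul_vtx_of_ne {v w : Q.V} (h : v ≠ w) : vtx k Q rel v * vtx k Q rel w = 0 := by
  rw [vtx, vtx, ← map_mul, RingQuot.mkAlgHom_rel k (GARel.orth v w h), map_zero]

theorem sum_vtx : ∑ v, vtx k Q rel v = 1 := by
  simp only [vtx]
  rw [← map_sum, RingQuot.mkAlgHom_rel k GARel.unit, map_one]

theorem vtx_src_mul_arr (a : Q.Arr) : vtx k Q rel (Q.src a) * arr k Q rel a = arr k Q rel a := by
  rw [vtx, arr, ← map_mul]; exact RingQuot.mkAlgHom_rel k (GARel.src_mul a)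

theorem arr_mul_vtx_tgt (a : Q.Arr) : arr k Q rel a * vtx k Q rel (Q.tgt a) = arr k Q rel a := by
  rw [vtx, arr, ← map_mul]; exact RingQuot.mkAlgHom_rel k (GARel.mul_tgt a)

theorem vtx_mul_arr_of_ne {v : Q.V} {a : Q.Arr} (h : v ≠ Q.src a) :
    vtx k Q rel v * arr k Q rel a = 0 := by
  rw [vtx, arr, ← map_mul, RingQuot.mkAlgHom_rel k (GARel.src_zero v a h), map_zero]

theorem arr_mul_arr_of_rel {a b : Q.Arr} (h : rel a b) :
    arr k Q rel a * arr k Q rel b = 0 := by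
  rw [arr, arr, ← map_mul, RingQuot.mkAlgHom_rel k (GARel.rel_zero a b h), map_zero]

@[elab_as_elim]
theorem GA_induction {p : GA k Q rel → Prop} (algMap : ∀ c, p (algebraMap k _ c))
    (vtx : ∀ v, p (vtx k Q rel v)) (arr : ∀ a, p (arr k Q rel a))
    (mul : ∀ x y, p x → p y → p (x * y)) (add : ∀ x y, p x → p y → p (x + y))
    (x : GA k Q rel) : p x := by
  obtain ⟨y, rfl⟩ := RingQuot.mkAlgHom_surjective k (GARel k Q rel) x
  induction y using FreeAlgebra.induction with
  | grade0 c => rw [AlgHom.commutes]; exact algMap c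
  | grade1 i => cases i with
    | inl v => exact vtx v
    | inr a => exact arr a
  | mul x y hx hy => rw [map_mul]; exact mul _ _ hx hy
  | add x y hx hy => rw [map_add]; exact add _ _ hx hy

open Classical in
/-- A partial map on paths, extended linearly by zero. -/
def partialOp (c : Q.V × List Q.Arr → Prop) (f : Q.V × List Q.Arr → Q.V × List Q.Arr) :
    Module.End k (Q.V × List Q.Arr →₀ k) :=
  Finsupp.lsum k fun p => if c p then Finsupp.lsingle (f p) else 0

open Classical in
theorem partialOp_single (c : Q.V × List Q.Arr → Prop)
    (f : Q.V × List Q.Arr → Q.V × List Q.Arr) (p : Q.V × List Q.Arr) (t : k) :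
    partialOp c f (Finsupp.single p t) = if c p then Finsupp.single (f p) t else 0 := by
  rw [partialOp, Finsupp.lsum_single]
  split_ifs <;> rfl

theorem partialOp_mul (c c' : Q.V × List Q.Arr → Prop)
    (f f' : Q.V × List Q.Arr → Q.V × List Q.Arr) :
    (partialOp c f * partialOp c' f' : Module.End k _) =
      partialOp (fun p => c' p ∧ c (f' p)) (f ∘ f') := by
  classical
  refine Finsupp.lhom_ext fun p t => ?_
  rw [Module.End.mul_apply, partialOp_single, partialOp_single]
  by_cases h : c' p <;> by_cases h' : c (f' p) <;> simp [h, h', partialOp_single]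

theorem partialOp_congr {c c' : Q.V × List Q.Arr → Prop}
    {f f' : Q.V × List Q.Arr → Q.V × List Q.Arr} (hc : ∀ p, c p ↔ c' p)
    (hf : ∀ p, c p → f p = f' p) : (partialOp c f : Module.End k _) = partialOp c' f' := by
  classical
  refine Finsupp.lhom_ext fun p t => ?_
  rw [partialOp_single, partialOp_single]
  by_cases h : c p
  · rw [if_pos h, if_pos ((hc p).1 h), hf p h]
  · rw [if_neg h, if_neg (fun h' => h ((hc p).2 h'))]

theorem partialOp_eq_zero {c : Q.V × List Q.Arr → Prop}
    {f : Q.V × List Q.Arr → Q.V × List Q.Arr} (hc : ∀ p, ¬ c p) :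
    (partialOp c f : Module.End k _) = 0 := by
  classical
  refine Finsupp.lhom_ext fun p t => ?_
  rw [partialOp_single, if_neg (hc p), LinearMap.zero_apply]

theorem partialOp_apply {c : Q.V × List Q.Arr → Prop}
    {f : Q.V × List Q.Arr → Q.V × List Q.Arr} (hf : Function.Injective f)
    {p : Q.V × List Q.Arr} (hp : c p) (m : Q.V × List Q.Arr →₀ k) :
    partialOp c f m (f p) = m p := by
  classical
  induction m using Finsupp.induction_linear with
  | zero => simp
  | add x y hx hy => rw [map_add, Finsupp.add_apply, hx, hy, Finsupp.add_apply]
  | single q t =>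
    rw [partialOp_single]
    by_cases h : q = p
    · subst h; simp [hp]
    · rw [Finsupp.single_eq_of_ne (Ne.symm h)]
      split_ifs
      · exact Finsupp.single_eq_of_ne fun h' => h (hf h').symm
      · rfl

theorem exists_of_partialOp_apply_ne_zero {c : Q.V × List Q.Arr → Prop}
    {f : Q.V × List Q.Arr → Q.V × List Q.Arr}
    {q : Q.V × List Q.Arr} {m : Q.V × List Q.Arr →₀ k} (h : partialOp c f m q ≠ 0) :
    ∃ p, c p ∧ q = f p := by
  classical
  contrapose! h
  induction m using Finsupp.induction_linear with
  | zero => simp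
  | add x y hx hy => rw [map_add, Finsupp.add_apply, hx, hy, add_zero]
  | single p t =>
    rw [partialOp_single]
    split_ifs with hc
    · exact Finsupp.single_eq_of_ne (h p hc)
    · rfl

variable (k rel) in
/-- Right multiplication by an arrow on paths. -/
def rightArr (a : Q.Arr) : Module.End k (Q.V × List Q.Arr →₀ k) :=
  partialOp (fun p => IsBasisPath rel (p.1, p.2 ++ [a])) fun p => (p.1, p.2 ++ [a])

variable (k rel) in
/-- Left multiplication by an arrow on paths. -/
def leftArr (a : Q.Arr) : Module.End k (Q.V × List Q.Arr →₀ k) :=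
  partialOp (fun p => p.1 = Q.tgt a ∧ IsBasisPath rel (Q.src a, a :: p.2))
    fun p => (Q.src a, a :: p.2)

variable (k) in
/-- Right multiplication by a stationary path. -/
def rightVtx (v : Q.V) : Module.End k (Q.V × List Q.Arr →₀ k) :=
  partialOp (fun p => wTgtD p.2 p.1 = v) id

variable (k) in
/-- Left multiplication by a stationary path. -/
def leftVtx (v : Q.V) : Module.End k (Q.V × List Q.Arr →₀ k) :=
  partialOp (fun p => p.1 = v) id

theorem leftArr_mul_rightArr (a b : Q.Arr) :
    leftArr k rel a * rightArr k rel b = rightArr k rel b * leftArr k rel a := by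
  rw [leftArr, rightArr, partialOp_mul, partialOp_mul]
  refine partialOp_congr ?_ fun _ _ => rfl
  rintro ⟨v, l⟩
  simp only
  constructor
  · rintro ⟨-, rfl, h⟩
    rw [← List.cons_append] at h
    exact ⟨⟨rfl, (isBasisPath_concat.1 h).1⟩, h⟩
  · rintro ⟨⟨rfl, -⟩, h⟩
    exact ⟨(isBasisPath_cons.1 h).2.1, rfl, h⟩

theorem leftArr_mul_rightVtx (a : Q.Arr) (v : Q.V) :
    leftArr k rel a * rightVtx k v = rightVtx k v * leftArr k rel a := by
  rw [leftArr, rightVtx, partialOp_mul, partialOp_mul]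
  refine partialOp_congr ?_ fun _ _ => rfl
  rintro ⟨w, l⟩
  simp only [id, wTgtD_cons]
  constructor
  · rintro ⟨h1, rfl, h⟩
    exact ⟨⟨rfl, h⟩, h1⟩
  · rintro ⟨⟨rfl, h⟩, h1⟩
    exact ⟨h1, rfl, h⟩

theorem leftVtx_mul_rightArr (v : Q.V) (b : Q.Arr) :
    leftVtx k v * rightArr k rel b = rightArr k rel b * leftVtx k v := by
  rw [leftVtx, rightArr, partialOp_mul, partialOp_mul]
  exact partialOp_congr (fun _ => and_comm) fun _ _ => rfl

theorem leftVtx_mul_rightVtx (v w : Q.V) :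
    (leftVtx k v * rightVtx k w : Module.End k _) = rightVtx k w * leftVtx k v := by
  rw [leftVtx, rightVtx, partialOp_mul, partialOp_mul]
  exact partialOp_congr (fun _ => and_comm) fun _ _ => rfl

theorem sum_rightVtx : ∑ v : Q.V, (rightVtx k v : Module.End k _) = 1 := by
  refine Finsupp.lhom_ext fun p t => ?_
  rw [LinearMap.sum_apply]
  simp [rightVtx, partialOp_single]

variable (k rel) in
/-- The action of the generators of the free algebra on paths from the right. -/
def rightActAux : FreeAlgebra k (Q.V ⊕ Q.Arr) →ₐ[k] (Module.End k (Q.V × List Q.Arr →₀ k))ᵐᵒᵖ :=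
  FreeAlgebra.lift k (Sum.elim (fun v => .op (rightVtx k v)) fun a => .op (rightArr k rel a))

theorem rightActAux_rel ⦃x y : FreeAlgebra k (Q.V ⊕ Q.Arr)⦄ (h : GARel k Q rel x y) :
    rightActAux k rel x = rightActAux k rel y := by
  cases h with
  | unit =>
    simp only [rightActAux, map_sum, FreeAlgebra.lift_ι_apply, Sum.elim_inl, map_one]
    rw [← MulOpposite.op_one, ← sum_rightVtx]
    exact (map_sum MulOpposite.opAddEquiv _ _).symm
  | idem v =>
    simp only [rightActAux, map_mul, FreeAlgebra.lift_ι_apply, Sum.elim_inl, ← MulOpposite.op_mul]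
    rw [rightVtx, partialOp_mul]
    congr 1
    exact partialOp_congr (fun _ => and_self_iff) fun _ _ => rfl
  | orth v w h =>
    simp only [rightActAux, map_mul, FreeAlgebra.lift_ι_apply, Sum.elim_inl, ← MulOpposite.op_mul,
      map_zero]
    rw [rightVtx, rightVtx, partialOp_mul, partialOp_eq_zero, MulOpposite.op_zero]
    rintro p ⟨h1, h2⟩
    exact h (h1.symm.trans h2)
  | src_mul a =>
    simp only [rightActAux, map_mul, FreeAlgebra.lift_ι_apply, Sum.elim_inl, Sum.elim_inr,
      ← MulOpposite.op_mul]
    rw [rightVtx, rightArr, partialOp_mul]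
    congr 1
    exact partialOp_congr (fun p => ⟨And.right, fun h => ⟨(isBasisPath_concat.1 h).2.1, h⟩⟩)
      fun _ _ => rfl
  | mul_tgt a =>
    simp only [rightActAux, map_mul, FreeAlgebra.lift_ι_apply, Sum.elim_inl, Sum.elim_inr,
      ← MulOpposite.op_mul]
    rw [rightVtx, rightArr, partialOp_mul]
    congr 1
    exact partialOp_congr (fun p => ⟨And.left, fun h => ⟨h, wTgtD_concat _ _ _⟩⟩)
      fun _ _ => rfl
  | src_zero v a h =>
    simp only [rightActAux, map_mul, FreeAlgebra.lift_ι_apply, Sum.elim_inl, Sum.elim_inr,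
      ← MulOpposite.op_mul, map_zero]
    rw [rightVtx, rightArr, partialOp_mul, partialOp_eq_zero, MulOpposite.op_zero]
    rintro p ⟨h1, h2⟩
    exact h (h1.symm.trans (isBasisPath_concat.1 h2).2.1)
  | tgt_zero v a h =>
    simp only [rightActAux, map_mul, FreeAlgebra.lift_ι_apply, Sum.elim_inl, Sum.elim_inr,
      ← MulOpposite.op_mul, map_zero]
    rw [rightVtx, rightArr, partialOp_mul, partialOp_eq_zero, MulOpposite.op_zero]
    rintro p ⟨h1, h2⟩
    exact h (h2.symm.trans (wTgtD_concat _ _ _))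
  | rel_zero a b h =>
    simp only [rightActAux, map_mul, FreeAlgebra.lift_ι_apply, Sum.elim_inr,
      ← MulOpposite.op_mul, map_zero]
    rw [rightArr, rightArr, partialOp_mul, partialOp_eq_zero, MulOpposite.op_zero]
    rintro p ⟨h1, h2⟩
    exact (isBasisPath_concat.1 h2).2.2 a (by simp) h

variable (k rel) in
/-- The right action of `A` on formal combinations of paths. -/
def rightAct : GA k Q rel →ₐ[k] (Module.End k (Q.V × List Q.Arr →₀ k))ᵐᵒᵖ :=
  RingQuot.liftAlgHom k ⟨rightActAux k rel, rightActAux_rel⟩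

theorem rightAct_vtx (v : Q.V) : rightAct k rel (vtx k Q rel v) = .op (rightVtx k v) := by
  simp [rightAct, vtx, rightActAux]

theorem rightAct_arr (a : Q.Arr) : rightAct k rel (arr k Q rel a) = .op (rightArr k rel a) := by
  simp [rightAct, arr, rightActAux]

variable (k Q) in
/-- The formal sum of all stationary paths. -/
def unitPath : Q.V × List Q.Arr →₀ k := ∑ v : Q.V, Finsupp.single (v, []) 1

/-- The coordinates of an element of `A` in the basis of paths. -/
def coords : GA k Q rel →ₗ[k] (Q.V × List Q.Arr →₀ k) where
  toFun x := (rightAct k rel x).unop (unitPath k Q)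
  map_add' x y := by simp
  map_smul' c x := by simp

theorem coords_mul (x y : GA k Q rel) : coords (x * y) = (rightAct k rel y).unop (coords x) := by
  simp [coords]

theorem coords_mul_arr (x : GA k Q rel) (a : Q.Arr) :
    coords (x * arr k Q rel a) = rightArr k rel a (coords x) := by
  rw [coords_mul, rightAct_arr, MulOpposite.unop_op]

theorem coords_mul_vtx (x : GA k Q rel) (v : Q.V) :
    coords (x * vtx k Q rel v) = rightVtx k v (coords x) := by
  rw [coords_mul, rightAct_vtx, MulOpposite.unop_op]

theorem coords_one : coords (1 : GA k Q rel) = unitPath k Q := by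
  simp [coords]

theorem apply_rightAct_of_comm {L : Module.End k (Q.V × List Q.Arr →₀ k)}
    (hV : ∀ v, L * rightVtx k v = rightVtx k v * L)
    (hA : ∀ a, L * rightArr k rel a = rightArr k rel a * L) (x : GA k Q rel) :
    L * (rightAct k rel x).unop = (rightAct k rel x).unop * L := by
  induction x using GA_induction with
  | algMap c =>
    rw [AlgHom.commutes]
    ext
    simp [Algebra.algebraMap_eq_smul_one]
  | vtx v => rw [rightAct_vtx]; exact hV v
  | arr a => rw [rightAct_arr]; exact hA a
  | mul x y hx hy =>
    rw [map_mul, MulOpposite.unop_mul, ← mul_assoc, hy, mul_assoc, hx, mul_assoc]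
  | add x y hx hy => rw [map_add, MulOpposite.unop_add, mul_add, hx, hy, add_mul]

theorem coords_arr_mul (a : Q.Arr) (x : GA k Q rel) :
    coords (arr k Q rel a * x) = leftArr k rel a (coords x) := by
  classical
  have h := LinearMap.congr_fun (apply_rightAct_of_comm (leftArr_mul_rightVtx a)
    (leftArr_mul_rightArr (k := k) (rel := rel) a) x) (unitPath k Q)
  rw [Module.End.mul_apply, Module.End.mul_apply] at h
  refine Eq.trans ?_ h.symm
  rw [coords_mul]
  congr 1
  rw [← one_mul (arr k Q rel a), coords_mul_arr, coords_one, unitPath, map_sum, map_sum]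
  simp [rightArr, leftArr, partialOp_single, isBasisPath_cons, isBasisPath_nil]

theorem coords_vtx_mul (v : Q.V) (x : GA k Q rel) :
    coords (vtx k Q rel v * x) = leftVtx k v (coords x) := by
  classical
  have h := LinearMap.congr_fun (apply_rightAct_of_comm (leftVtx_mul_rightVtx v)
    (leftVtx_mul_rightArr (k := k) (rel := rel) v) x) (unitPath k Q)
  rw [Module.End.mul_apply, Module.End.mul_apply] at h
  refine Eq.trans ?_ h.symm
  rw [coords_mul]
  congr 1
  rw [← one_mul (vtx k Q rel v), coords_mul_vtx, coords_one, unitPath, map_sum, map_sum]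
  refine Finset.sum_congr rfl fun w _ => ?_
  simp only [rightVtx, leftVtx, partialOp_single, wTgtD_nil]
  rfl

end Coordinates

section Elements

variable {k : Type} [Field k] {Q : Quiv} {rel : Q.Arr → Q.Arr → Prop}

variable (k rel) in
/-- The image in `A` of the path with given source and word. -/
def pathEl (p : Q.V × List Q.Arr) : GA k Q rel := vtx k Q rel p.1 * wordEl k Q rel p.2

theorem pathEl_nil (v : Q.V) : pathEl k rel (v, []) = vtx k Q rel v := by
  simp [pathEl, wordEl]

theorem pathEl_cons (a : Q.Arr) (l : List Q.Arr) :
    pathEl k rel (Q.src a, a :: l) = arr k Q rel a * pathEl k rel (Q.tgt a, l) := by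
  simp only [pathEl, wordEl, List.map_cons, List.prod_cons]
  rw [← mul_assoc, ← mul_assoc, vtx_src_mul_arr, arr_mul_vtx_tgt]

theorem pathEl_concat (v : Q.V) (l : List Q.Arr) (a : Q.Arr) :
    pathEl k rel (v, l ++ [a]) = pathEl k rel (v, l) * arr k Q rel a := by
  simp [pathEl, wordEl, mul_assoc]

theorem pathEl_mul_vtx (v : Q.V) (l : List Q.Arr) :
    pathEl k rel (v, l) * vtx k Q rel (wTgtD l v) = pathEl k rel (v, l) := by
  rcases List.eq_nil_or_concat' l with rfl | ⟨l, a, rfl⟩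
  · rw [pathEl_nil, wTgtD_nil, vtx_mul_self]
  · rw [pathEl_concat, wTgtD_concat, mul_assoc, arr_mul_vtx_tgt]

theorem pathEl_eq_zero {p : Q.V × List Q.Arr} (h : ¬ IsBasisPath rel p) :
    pathEl k rel p = 0 := by
  obtain ⟨v, l⟩ := p
  induction l generalizing v with
  | nil => exact absurd (isBasisPath_nil v) h
  | cons a l ih =>
    by_cases hv : v = Q.src a
    · subst hv
      rw [pathEl_cons]
      by_cases hl : IsBasisPath rel (Q.tgt a, l)
      · rw [isBasisPath_cons] at h
        push Not at h
        obtain ⟨b, hb, hab⟩ := h rfl hl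
        cases l with
        | nil => simp at hb
        | cons c l =>
          obtain rfl : c = b := by simpa using hb
          rw [← (isBasisPath_cons.1 hl).1.symm, pathEl_cons, ← mul_assoc,
            arr_mul_arr_of_rel hab, zero_mul]
      · rw [ih _ hl, mul_zero]
    · simp only [pathEl, wordEl, List.map_cons, List.prod_cons]
      rw [← mul_assoc, vtx_mul_arr_of_ne hv, zero_mul]

variable (k rel) in
/-- The element of `A` with given coordinates. -/
def ofCoords : (Q.V × List Q.Arr →₀ k) →ₗ[k] GA k Q rel :=
  Finsupp.linearCombination k (pathEl k rel)

theorem ofCoords_rightArr (m : Q.V × List Q.Arr →₀ k) (a : Q.Arr) :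
    ofCoords k rel (rightArr k rel a m) = ofCoords k rel m * arr k Q rel a := by
  classical
  induction m using Finsupp.induction_linear with
  | zero => simp
  | add x y hx hy => rw [map_add, map_add, hx, hy, map_add, add_mul]
  | single p t =>
    rw [rightArr, partialOp_single]
    by_cases h : IsBasisPath rel (p.1, p.2 ++ [a])
    · rw [if_pos h, ofCoords, Finsupp.linearCombination_single, Finsupp.linearCombination_single,
        pathEl_concat, smul_mul_assoc]
    · rw [if_neg h, map_zero, ofCoords, Finsupp.linearCombination_single, smul_mul_assoc,
        ← pathEl_concat, pathEl_eq_zero h, smul_zero]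

theorem ofCoords_rightVtx (m : Q.V × List Q.Arr →₀ k) (v : Q.V) :
    ofCoords k rel (rightVtx k v m) = ofCoords k rel m * vtx k Q rel v := by
  classical
  induction m using Finsupp.induction_linear with
  | zero => simp
  | add x y hx hy => rw [map_add, map_add, hx, hy, map_add, add_mul]
  | single p t =>
    obtain ⟨w, l⟩ := p
    rw [rightVtx, partialOp_single]
    by_cases h : wTgtD l w = v
    · rw [if_pos h, id, ofCoords, Finsupp.linearCombination_single, smul_mul_assoc, ← h,
        pathEl_mul_vtx]
    · rw [if_neg h, map_zero, ofCoords, Finsupp.linearCombination_single, smul_mul_assoc,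
        ← pathEl_mul_vtx, mul_assoc, vtx_mul_vtx_of_ne h, mul_zero, smul_zero]

theorem ofCoords_rightAct (x : GA k Q rel) (m : Q.V × List Q.Arr →₀ k) :
    ofCoords k rel ((rightAct k rel x).unop m) = ofCoords k rel m * x := by
  induction x using GA_induction generalizing m with
  | algMap c =>
    rw [AlgHom.commutes]
    simp [Algebra.algebraMap_eq_smul_one]
  | vtx v => rw [rightAct_vtx]; exact ofCoords_rightVtx m v
  | arr a => rw [rightAct_arr]; exact ofCoords_rightArr m a
  | mul x y hx hy =>
    rw [map_mul, MulOpposite.unop_mul, Module.End.mul_apply, hy, hx, mul_assoc]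
  | add x y hx hy =>
    rw [map_add, MulOpposite.unop_add, LinearMap.add_apply, map_add, hx, hy, mul_add]

theorem ofCoords_coords (x : GA k Q rel) : ofCoords k rel (coords x) = x := by
  refine (ofCoords_rightAct x _).trans ?_
  rw [unitPath, map_sum, ofCoords]
  simp [Finsupp.linearCombination_single, pathEl_nil, sum_vtx]

theorem coords_injective : Function.Injective (coords (k := k) (rel := rel)) :=
  Function.LeftInverse.injective ofCoords_coords

theorem mem_of_coords {N : Submodule k (GA k Q rel)} {x : GA k Q rel}
    (h : ∀ p, coords x p ≠ 0 → pathEl k rel p ∈ N) : x ∈ N := by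
  rw [← ofCoords_coords x, ofCoords, Finsupp.linearCombination_apply]
  exact Submodule.sum_mem _ fun p hp => N.smul_mem _ (h p (Finsupp.mem_support_iff.1 hp))

theorem exists_coords_ne_zero {x : GA k Q rel} (h : x ≠ 0) : ∃ p, coords x p ≠ 0 := by
  by_contra! h'
  exact h (coords_injective (by rw [map_zero]; exact Finsupp.ext h'))

theorem coords_vtx (v : Q.V) :
    coords (vtx k Q rel v) = Finsupp.single (v, []) 1 := by
  classical
  rw [← one_mul (vtx k Q rel v), coords_mul_vtx, coords_one, unitPath, map_sum]
  rw [Finset.sum_eq_single v] <;> simp +contextual [rightVtx, partialOp_single, wTgtD_nil]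

theorem coords_pathEl {p : Q.V × List Q.Arr} (h : IsBasisPath rel p) :
    coords (pathEl k rel p) = Finsupp.single p 1 := by
  classical
  obtain ⟨v, l⟩ := p
  induction l using List.reverseRecOn with
  | nil => rw [pathEl_nil, coords_vtx]
  | append_singleton l a ih =>
    rw [pathEl_concat, coords_mul_arr, ih (isBasisPath_concat.1 h).1, rightArr, partialOp_single,
      if_pos h]

theorem isBasisPath_of_coords_ne_zero {x : GA k Q rel} {p : Q.V × List Q.Arr}
    (h : coords x p ≠ 0) : IsBasisPath rel p := by
  classical
  by_contra hp
  refine h ?_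
  have : x ∈ LinearMap.ker (Finsupp.lapply p ∘ₗ coords (k := k) (rel := rel)) := by
    refine mem_of_coords fun q _ => ?_
    rw [LinearMap.mem_ker, LinearMap.comp_apply, Finsupp.lapply_apply]
    by_cases hq : IsBasisPath rel q
    · rw [coords_pathEl hq, Finsupp.single_eq_of_ne]
      rintro rfl
      exact hp hq
    · rw [pathEl_eq_zero hq, map_zero, Finsupp.zero_apply]
  exact this

theorem coords_mul_arr_concat (x : GA k Q rel) {v : Q.V} {l : List Q.Arr} {a : Q.Arr}
    (h : IsBasisPath rel (v, l ++ [a])) :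
    coords (x * arr k Q rel a) (v, l ++ [a]) = coords x (v, l) := by
  rw [coords_mul_arr]
  refine partialOp_apply (k := k)
    (c := fun p : Q.V × List Q.Arr => IsBasisPath rel (p.1, p.2 ++ [a]))
    (f := fun p : Q.V × List Q.Arr => (p.1, p.2 ++ [a])) ?_ (p := (v, l)) h _
  rintro ⟨v, l⟩ ⟨w, m⟩ h
  simpa using h

theorem coords_arr_mul_cons (x : GA k Q rel) {l : List Q.Arr} {a : Q.Arr}
    (h : IsBasisPath rel (Q.src a, a :: l)) :
    coords (arr k Q rel a * x) (Q.src a, a :: l) = coords x (Q.tgt a, l) := by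
  rw [coords_arr_mul, leftArr]
  have hpartial := partialOp_congr (k := k)
    (c := fun p : Q.V × List Q.Arr => p.1 = Q.tgt a ∧ IsBasisPath rel (Q.src a, a :: p.2))
    (c' := fun p : Q.V × List Q.Arr => p.1 = Q.tgt a ∧ IsBasisPath rel (Q.src a, a :: p.2))
    (f := fun p => (Q.src a, a :: p.2))
    (f' := fun p => (Equiv.swap (Q.src a) (Q.tgt a) p.1, a :: p.2))
    (fun _ => Iff.rfl) (fun p hp => by rw [hp.1, Equiv.swap_apply_right])
  rw [hpartial]
  have := partialOp_apply (k := k)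
    (c := fun p : Q.V × List Q.Arr => p.1 = Q.tgt a ∧ IsBasisPath rel (Q.src a, a :: p.2))
    (f := fun p : Q.V × List Q.Arr => (Equiv.swap (Q.src a) (Q.tgt a) p.1, a :: p.2))
    (fun p q hpq => by simpa [Prod.ext_iff] using hpq) (p := (Q.tgt a, l)) ⟨rfl, h⟩ (coords x)
  simpa using this

theorem fst_eq_of_coords_ne_zero {x : GA k Q rel} {v : Q.V} (hx : vtx k Q rel v * x = x)
    {p : Q.V × List Q.Arr} (h : coords x p ≠ 0) : p.1 = v := by
  rw [← hx, coords_vtx_mul] at h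
  obtain ⟨q, hq, rfl⟩ := exists_of_partialOp_apply_ne_zero h
  exact hq

theorem wTgtD_eq_of_coords_ne_zero {x : GA k Q rel} {v : Q.V} (hx : x * vtx k Q rel v = x)
    {p : Q.V × List Q.Arr} (h : coords x p ≠ 0) : wTgtD p.2 p.1 = v := by
  rw [← hx, coords_mul_vtx] at h
  obtain ⟨q, hq, rfl⟩ := exists_of_partialOp_apply_ne_zero h
  exact hq

theorem exists_cons_of_coords_arr_mul_ne_zero {x : GA k Q rel} {a : Q.Arr}
    {p : Q.V × List Q.Arr} (h : coords (arr k Q rel a * x) p ≠ 0) : ∃ l, p.2 = a :: l := by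
  rw [coords_arr_mul] at h
  obtain ⟨q, hq, rfl⟩ := exists_of_partialOp_apply_ne_zero h
  exact ⟨_, rfl⟩

theorem exists_concat_of_coords_mul_arr_ne_zero {x : GA k Q rel} {a : Q.Arr}
    {p : Q.V × List Q.Arr} (h : coords (x * arr k Q rel a) p ≠ 0) : ∃ l, p.2 = l ++ [a] := by
  rw [coords_mul_arr] at h
  obtain ⟨q, hq, rfl⟩ := exists_of_partialOp_apply_ne_zero h
  exact ⟨_, rfl⟩

theorem mem_of_arr_mul_eq_zero {N : Submodule k (GA k Q rel)} {a : Q.Arr} {x : GA k Q rel}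
    (hx : vtx k Q rel (Q.tgt a) * x = x) (h : arr k Q rel a * x = 0)
    (hN : ∀ c, rel a c → ∀ y, arr k Q rel c * y ∈ N) : x ∈ N := by
  refine mem_of_coords fun p hp => ?_
  obtain ⟨v, l⟩ := p
  obtain rfl : v = Q.tgt a := fst_eq_of_coords_ne_zero hx hp
  have hl := isBasisPath_of_coords_ne_zero hp
  have hal : ¬ IsBasisPath rel (Q.src a, a :: l) := fun hal => hp <| by
    rw [← coords_arr_mul_cons x hal, h, map_zero, Finsupp.zero_apply]
  rw [isBasisPath_cons] at hal
  push Not at hal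
  obtain ⟨c, hc, hac⟩ := hal rfl hl
  cases l with
  | nil => simp at hc
  | cons d l =>
    obtain rfl : d = c := by simpa using hc
    rw [(isBasisPath_cons.1 hl).1, pathEl_cons]
    exact hN _ hac _

theorem mem_of_mul_arr_eq_zero {N : Submodule k (GA k Q rel)} {b : Q.Arr} {x : GA k Q rel}
    (hx : x * vtx k Q rel (Q.src b) = x) (h : x * arr k Q rel b = 0)
    (hN : ∀ c, rel c b → ∀ y, y * arr k Q rel c ∈ N) : x ∈ N := by
  refine mem_of_coords fun p hp => ?_
  obtain ⟨v, l⟩ := p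
  have hv : wTgtD l v = Q.src b := wTgtD_eq_of_coords_ne_zero hx hp
  have hl := isBasisPath_of_coords_ne_zero hp
  have hlb : ¬ IsBasisPath rel (v, l ++ [b]) := fun hlb => hp <| by
    rw [← coords_mul_arr_concat x hlb, h, map_zero, Finsupp.zero_apply]
  rw [isBasisPath_concat] at hlb
  push Not at hlb
  obtain ⟨c, hc, hcb⟩ := hlb hl hv
  rcases List.eq_nil_or_concat' l with rfl | ⟨l, d, rfl⟩
  · simp at hc
  · obtain rfl : d = c := by simpa using hc
    rw [pathEl_concat]
    exact hN _ hcb _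

theorem arr_mul_eq_zero_of_sum {f : Q.Arr → GA k Q rel} (h : ∑ a, arr k Q rel a * f a = 0)
    (a : Q.Arr) : arr k Q rel a * f a = 0 := by
  by_contra ha
  obtain ⟨p, hp⟩ := exists_coords_ne_zero ha
  obtain ⟨l, hl⟩ := exists_cons_of_coords_arr_mul_ne_zero hp
  have h' := DFunLike.congr_fun (congrArg coords h) p
  rw [map_sum, map_zero, Finsupp.zero_apply, Finsupp.finsetSum_apply,
    Finset.sum_eq_single a] at h'
  · exact hp h'
  · intro b _ hb
    by_contra hbp
    obtain ⟨l', hl'⟩ := exists_cons_of_coords_arr_mul_ne_zero hbp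
    exact hb (List.cons.inj (hl'.symm.trans hl)).1
  · simp

theorem vtx_ne_mul_arr (v : Q.V) (x : GA k Q rel) (a : Q.Arr) :
    vtx k Q rel v ≠ x * arr k Q rel a := by
  intro h
  have hp : coords (x * arr k Q rel a) (v, []) ≠ 0 := by
    rw [← h, coords_vtx]; simp
  obtain ⟨l, hl⟩ := exists_concat_of_coords_mul_arr_ne_zero hp
  simp at hl

theorem mul_arr_ne_zero_of_mul_arr_eq {x : GA k Q rel} {a b : Q.Arr} (hab : Q.src a = Q.src b)
    (h : x * arr k Q rel a = arr k Q rel a) : x * arr k Q rel b ≠ 0 := by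
  intro h'
  have hbp (c : Q.Arr) : IsBasisPath rel (Q.src c, [] ++ [c]) := by
    simp [isBasisPath_cons, isBasisPath_nil]
  have ha := coords_mul_arr_concat x (hbp a)
  have hb := coords_mul_arr_concat x (hbp b)
  have ha' := coords_mul_arr_concat (vtx k Q rel (Q.src a)) (hbp a)
  rw [vtx_src_mul_arr] at ha'
  rw [h, hab, ← hb, h'] at ha
  rw [← hab] at ha
  rw [ha', coords_vtx] at ha
  simp at ha

theorem vtxHom_mkAlgHom (v : Q.V) (y : FreeAlgebra k (Q.V ⊕ Q.Arr)) :
    vtxHom k Q rel v (RingQuot.mkAlgHom k (GARel k Q rel) y) = vtxHomAux k Q v y := by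
  rw [← AlgHom.coe_toRingHom, RingQuot.mkAlgHom_coe, vtxHom, RingQuot.lift_mkRingHom_apply]
  rfl

theorem vtxHom_vtx (v w : Q.V) : vtxHom k Q rel v (vtx k Q rel w) = if w = v then 1 else 0 := by
  rw [vtx, vtxHom_mkAlgHom]; simp [vtxHomAux]

theorem vtxHom_arr (v : Q.V) (a : Q.Arr) : vtxHom k Q rel v (arr k Q rel a) = 0 := by
  rw [arr, vtxHom_mkAlgHom]; simp [vtxHomAux]

theorem vtxHom_algebraMap (v : Q.V) (c : k) :
    vtxHom k Q rel v (algebraMap k (GA k Q rel) c) = c := by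
  rw [← (RingQuot.mkAlgHom k (GARel k Q rel)).commutes, vtxHom_mkAlgHom, AlgHom.commutes]
  rfl

variable (k rel) in
/-- The `k`-linear map underlying `vtxHom`. -/
def vtxLin (v : Q.V) : GA k Q rel →ₗ[k] k where
  toFun := vtxHom k Q rel v
  map_add' := map_add _
  map_smul' c x := by
    rw [Algebra.smul_def, map_mul, vtxHom_algebraMap, RingHom.id_apply, smul_eq_mul]

theorem vtxHom_eq_coords (v : Q.V) (x : GA k Q rel) :
    vtxHom k Q rel v x = coords x (v, []) := by
  classical
  have : x ∈ LinearMap.eqLocus (vtxLin k rel v)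
      (Finsupp.lapply (v, []) ∘ₗ coords (k := k) (rel := rel)) := by
    refine mem_of_coords fun p hp => ?_
    rw [LinearMap.mem_eqLocus, LinearMap.comp_apply, Finsupp.lapply_apply,
      coords_pathEl (isBasisPath_of_coords_ne_zero hp)]
    change vtxHom k Q rel v _ = _
    obtain ⟨w, l⟩ := p
    cases l with
    | nil => rw [pathEl_nil, vtxHom_vtx, Finsupp.single_apply]; simp
    | cons a l => simp [pathEl, wordEl, vtxHom_arr]
  exact this

theorem mem_of_vtxHom_eq_zero {N : Submodule k (GA k Q rel)} {v : Q.V} {x : GA k Q rel}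
    (hx : vtx k Q rel v * x = x) (h : vtxHom k Q rel v x = 0)
    (hN : ∀ a, Q.src a = v → ∀ y, arr k Q rel a * y ∈ N) : x ∈ N := by
  refine mem_of_coords fun p hp => ?_
  obtain ⟨w, l⟩ := p
  obtain rfl : w = v := fst_eq_of_coords_ne_zero hx hp
  cases l with
  | nil => exact absurd ((vtxHom_eq_coords w x).symm.trans h) hp
  | cons a l =>
    obtain rfl := (isBasisPath_cons.1 (isBasisPath_of_coords_ne_zero hp)).1
    rw [pathEl_cons]
    exact hN a rfl _

end Elements

section Words

variable {Q : Quiv} {rel : Q.Arr → Q.Arr → Prop}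

theorem allowedWord_concat {a : Q.Arr} {l : List Q.Arr} :
    AllowedWord rel (l ++ [a]) ↔
      AllowedWord rel l ∧ ∀ b ∈ l.getLast?, Q.tgt b = Q.src a ∧ ¬ rel b a := by
  unfold AllowedWord
  rw [List.Chain', List.Chain', List.isChain_append]
  simp

theorem eq_of_rel (hg : IsGentleRel Q rel) {a b c : Q.Arr} (hb : rel a b) (hc : rel a c) :
    b = c := by
  by_contra h
  have := hg.cond_iii a b c h (hg.rel_comp _ _ hb) (hg.rel_comp _ _ hc)
  simp [Xor', hb, hc] at this

theorem eq_of_not_rel (hg : IsGentleRel Q rel) {a b c : Q.Arr} (hb : Q.tgt a = Q.src b)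
    (hc : Q.tgt a = Q.src c) (hab : ¬ rel a b) (hac : ¬ rel a c) : b = c := by
  by_contra h
  have := hg.cond_iii a b c h hb hc
  simp [Xor', hab, hac] at this

theorem eq_of_rel_left (hg : IsGentleRel Q rel) {a b c : Q.Arr} (hb : rel b a) (hc : rel c a) :
    b = c := by
  by_contra h
  have := hg.cond_ii a b c h (hg.rel_comp _ _ hb) (hg.rel_comp _ _ hc)
  simp [Xor', hb, hc] at this

open Classical in
variable (rel) in
/-- The arrow continuing `a` to a forbidden path of length two, if there is one. -/
def step (a : Q.Arr) : Option Q.Arr := if h : ∃ b, rel a b then some h.choose else none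

theorem step_eq_some (hg : IsGentleRel Q rel) {a b : Q.Arr} :
    step rel a = some b ↔ rel a b := by
  unfold step
  split_ifs with h
  · rw [Option.some_inj]
    exact ⟨fun hb => hb ▸ h.choose_spec, fun hb => eq_of_rel hg h.choose_spec hb⟩
  · simp only [false_iff]
    exact fun hb => h ⟨b, hb⟩

theorem step_eq_none {a : Q.Arr} : step rel a = none ↔ ∀ b, ¬ rel a b := by
  unfold step
  split_ifs with h <;> simpa using h

variable (rel) in
/-- The last arrow of the forbidden path of length `n + 1` with source `v` and first arrow `a`,
if there is one. -/
def nthArr (v : Q.V) : ℕ → Q.Arr → Option Q.Arr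
  | 0, a => if Q.src a = v then some a else none
  | n + 1, a => (nthArr v n a).bind (step rel)

theorem nthArr_zero_eq_some {v : Q.V} {a b : Q.Arr} :
    nthArr rel v 0 a = some b ↔ Q.src a = v ∧ a = b := by
  simp [nthArr]

theorem nthArr_succ_eq_some (hg : IsGentleRel Q rel) {v : Q.V} {n : ℕ} {a b : Q.Arr} :
    nthArr rel v (n + 1) a = some b ↔ ∃ c, nthArr rel v n a = some c ∧ rel c b := by
  simp [nthArr, Option.bind_eq_some_iff, step_eq_some hg]

theorem not_dualRel_iff (hg : IsGentleRel Q rel) {a b : Q.Arr} :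
    Q.tgt a = Q.src b ∧ ¬ dualRel rel a b ↔ rel a b := by
  have := hg.rel_comp a b
  unfold dualRel
  tauto

theorem exists_forbiddenWord_iff (hg : IsGentleRel Q rel) {v : Q.V} {n : ℕ} {b : Q.Arr} :
    (∃ l, AllowedWord (dualRel rel) l ∧ l.length = n + 1 ∧ wSrc? l = some v ∧
      l.getLast? = some b) ↔ ∃ a, nthArr rel v n a = some b := by
  induction n generalizing b with
  | zero =>
    simp only [nthArr_zero_eq_some]
    constructor
    · rintro ⟨l, -, hl, hv, hb⟩
      obtain ⟨a, rfl⟩ := List.length_eq_one_iff.1 hl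
      exact ⟨a, by simpa [wSrc?] using hv, by simpa using hb⟩
    · rintro ⟨a, hv, rfl⟩
      exact ⟨[a], List.isChain_singleton _, rfl, by simpa [wSrc?] using hv, rfl⟩
  | succ n ih =>
    simp only [nthArr_succ_eq_some hg]
    rw [exists_comm]
    simp only [exists_and_right, ← ih]
    constructor
    · rintro ⟨l, hl, hn, hv, hb⟩
      rcases List.eq_nil_or_concat' l with rfl | ⟨l, d, rfl⟩
      · simp at hn
      · obtain rfl : d = b := by simpa using hb
        have hn' : l.length = n + 1 := by simpa using hn
        have hne : l ≠ [] := by rintro rfl; simp at hn'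
        rw [allowedWord_concat] at hl
        refine ⟨l.getLast hne, ⟨l, hl.1, hn', ?_, List.getLast?_eq_some_getLast hne⟩, ?_⟩
        · rw [← hv, wSrc?, wSrc?, List.head?_append_of_ne_nil _ hne]
        · exact (not_dualRel_iff hg).1 (hl.2 _ (List.getLast?_eq_some_getLast hne))
    · rintro ⟨c, ⟨l, hl, hn, hv, hc⟩, hcb⟩
      have hne : l ≠ [] := by rintro rfl; simp at hn
      refine ⟨l ++ [b], allowedWord_concat.2 ⟨hl, ?_⟩, by simpa using hn, ?_, by simp⟩
      · rw [hc]
        rintro d hd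
        obtain rfl : c = d := by simpa using hd
        exact (not_dualRel_iff hg).2 hcb
      · rw [← hv, wSrc?, wSrc?, List.head?_append_of_ne_nil _ hne]

theorem exists_rightMaxWord_dualRel_iff (hg : IsGentleRel Q rel) {v : Q.V} {n : ℕ} :
    (∃ l, RightMaxWord (dualRel rel) l ∧ l.length = n + 1 ∧ wSrc? l = some v) ↔
      ∃ a b, nthArr rel v n a = some b ∧ step rel b = none := by
  rw [exists_comm]
  simp only [exists_and_right, ← exists_forbiddenWord_iff hg, step_eq_none]
  constructor
  · rintro ⟨l, ⟨hne, hl, hmax⟩, hn, hv⟩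
    refine ⟨l.getLast hne, ⟨l, hl, hn, hv, List.getLast?_eq_some_getLast hne⟩, fun c hc => ?_⟩
    refine hmax c (allowedWord_concat.2 ⟨hl, ?_⟩)
    rw [List.getLast?_eq_some_getLast hne]
    rintro d hd
    obtain rfl : _ = d := by simpa using hd
    exact (not_dualRel_iff hg).2 hc
  · rintro ⟨b, ⟨l, hl, hn, hv, hb⟩, hmax⟩
    refine ⟨l, ⟨by rintro rfl; simp at hn, hl, fun c hc => ?_⟩, hn, hv⟩
    exact hmax c ((not_dualRel_iff hg).1 ((allowedWord_concat.1 hc).2 b hb))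

theorem RightMaxWord.of_append {s l : List Q.Arr} (h : RightMaxWord rel (s ++ l)) (hl : l ≠ []) :
    RightMaxWord rel l := by
  refine ⟨hl, (List.isChain_append.1 h.2.1).2.1, fun a ha => h.2.2 a ?_⟩
  refine allowedWord_concat.2 ⟨h.2.1, ?_⟩
  rw [List.getLast?_append_of_ne_nil _ hl]
  exact (allowedWord_concat.1 ha).2

theorem RightMaxWord.isPrefix (hg : IsGentleRel Q rel) {a : Q.Arr} {u w : List Q.Arr}
    (hu : RightMaxWord rel (a :: u)) (hw : AllowedWord rel (a :: w)) : w <+: u := by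
  induction w generalizing a u with
  | nil => exact List.nil_prefix
  | cons b w ih =>
    have hb := (allowedWord_cons.1 hw).1 b rfl
    cases u with
    | nil =>
      refine absurd (allowedWord_concat.2 ⟨hu.2.1, ?_⟩) (hu.2.2 b)
      rintro d hd
      obtain rfl : a = d := by simpa using hd
      exact hb
    | cons c u =>
      have hc := (allowedWord_cons.1 hu.2.1).1 c rfl
      obtain rfl := eq_of_not_rel hg hb.1 hc.1 hb.2 hc.2
      rw [List.cons_prefix_cons]
      exact ⟨rfl, ih (RightMaxWord.of_append (s := [a]) hu (by simp)) (allowedWord_cons.1 hw).2⟩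

theorem RightMaxWord.nodup (hg : IsGentleRel Q rel) {l : List Q.Arr} (h : RightMaxWord rel l) :
    l.Nodup := by
  induction l with
  | nil => exact List.nodup_nil
  | cons a u ih =>
    refine List.nodup_cons.2 ⟨fun ha => ?_, ?_⟩
    · obtain ⟨s, r, rfl⟩ := List.append_of_mem ha
      have := (RightMaxWord.isPrefix hg
        (RightMaxWord.of_append (s := a :: s) h (by simp)) h.2.1).length_le
      simp at this
      omega
    · rcases eq_or_ne u [] with rfl | hu
      · exact List.nodup_nil
      · exact ih (RightMaxWord.of_append (s := [a]) h hu)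

theorem RightMaxWord.exists_finiteMaxWord (hg : IsGentleRel Q rel) {l : List Q.Arr}
    (h : RightMaxWord rel l) : ∃ m, FiniteMaxWord rel m ∧ wTgt? m = wTgt? l := by
  obtain ⟨n, hn⟩ : ∃ n, Fintype.card Q.Arr ≤ n + l.length := ⟨_, Nat.le_add_right _ _⟩
  induction n generalizing l with
  | zero =>
    refine ⟨l, ⟨h, h.1, h.2.1, fun a ha => ?_⟩, rfl⟩
    have hal : RightMaxWord rel (a :: l) :=
      ⟨by simp, ha, fun b hb => h.2.2 b (allowedWord_cons.1 hb).2⟩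
    have := (hal.nodup hg).length_le_card
    simp at this
    omega
  | succ n ih =>
    by_cases hl : ∀ a, ¬ AllowedWord rel (a :: l)
    · exact ⟨l, ⟨h, h.1, h.2.1, hl⟩, rfl⟩
    · push Not at hl
      obtain ⟨a, ha⟩ := hl
      have hal : RightMaxWord rel (a :: l) :=
        ⟨by simp, ha, fun b hb => h.2.2 b (allowedWord_cons.1 hb).2⟩
      obtain ⟨m, hm, hm'⟩ := ih hal (by simp; omega)
      refine ⟨m, hm, hm'.trans ?_⟩
      rw [wTgt?, wTgt?, ← List.singleton_append, List.getLast?_append_of_ne_nil _ h.1]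

theorem exists_arr_of_vtx (v : Q.V) : ∃ a, Q.src a = v ∨ Q.tgt a = v := by
  obtain ⟨a⟩ := Q.nonemptyA
  obtain ⟨w⟩ := Q.connected.preconnected v (Q.src a)
  cases w with
  | nil => exact ⟨a, .inl rfl⟩
  | cons h _ =>
    obtain ⟨-, ⟨b, hb, -⟩ | ⟨b, -, hb⟩⟩ := (SimpleGraph.fromRel_adj _ _ _).1 h
    · exact ⟨b, .inl hb⟩
    · exact ⟨b, .inr hb⟩

theorem exists_finiteMaxWord_iff (k : Type) [Field k] (hg : IsGentleRel Q rel) {v : Q.V} :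
    (∃ l : List Q.Arr, FiniteMaxWord rel l ∧ wTgt? l = some v) ↔
      ∃ y : GA k Q rel, y ≠ 0 ∧ y * vtx k Q rel v = y ∧
        ∀ a, Q.src a = v → y * arr k Q rel a = 0 := by
  constructor
  · rintro ⟨l, ⟨h, -⟩, hv⟩
    obtain ⟨a, u, rfl⟩ := List.exists_cons_of_ne_nil h.1
    have hb : IsBasisPath rel (Q.src a, a :: u) := ⟨by simp, h.2.1⟩
    have hv' : wTgtD (a :: u) (Q.src a) = v := by
      rw [wTgt?] at hv
      rw [wTgtD, hv, Option.getD_some]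
    refine ⟨pathEl k rel (Q.src a, a :: u), fun h0 => ?_, ?_, fun b _ => ?_⟩
    · have := coords_pathEl (k := k) hb
      rw [h0, map_zero, eq_comm, Finsupp.single_eq_zero] at this
      exact one_ne_zero this
    · rw [← hv', pathEl_mul_vtx]
    · rw [← pathEl_concat, pathEl_eq_zero fun hp => h.2.2 b hp.2]
  · rintro ⟨y, hy, hyv, hya⟩
    obtain ⟨⟨w, l⟩, hp⟩ := exists_coords_ne_zero hy
    have hv : wTgtD l w = v := wTgtD_eq_of_coords_ne_zero hyv hp
    have hl := isBasisPath_of_coords_ne_zero hp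
    have hmax (a : Q.Arr) (ha : Q.src a = v) : ¬ IsBasisPath rel (w, l ++ [a]) := fun hla => hp <| by
      rw [← coords_mul_arr_concat y hla, hya a ha, map_zero, Finsupp.zero_apply]
    rcases eq_or_ne l [] with rfl | hne
    · obtain rfl : w = v := hv
      have hw (a : Q.Arr) : Q.src a ≠ w := fun ha => hmax a ha ⟨by simpa using ha,
        List.isChain_singleton _⟩
      obtain ⟨a, ha | ha⟩ := exists_arr_of_vtx w
      · exact absurd ha (hw a)
      have : RightMaxWord rel [a] := ⟨by simp, List.isChain_singleton _, fun b hb =>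
        hw b (((allowedWord_concat.1 hb).2 a rfl).1.symm.trans ha)⟩
      obtain ⟨m, hm, hm'⟩ := this.exists_finiteMaxWord hg
      exact ⟨m, hm, hm'.trans (congrArg some ha)⟩
    · have hv' : wTgt? l = some v := by
        rw [wTgtD, List.getLast?_eq_some_getLast hne, Option.map_some, Option.getD_some] at hv
        rw [wTgt?, List.getLast?_eq_some_getLast hne, Option.map_some, hv]
      have : RightMaxWord rel l := by
        refine ⟨hne, hl.2, fun a ha => hmax a ?_ ⟨?_, ha⟩⟩
        · rw [← ((allowedWord_concat.1 ha).2 _ (List.getLast?_eq_some_getLast hne)).1]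
          rw [wTgt?, List.getLast?_eq_some_getLast hne] at hv'
          simpa using hv'
        · rw [List.head?_append_of_ne_nil _ hne]
          exact hl.1
      obtain ⟨m, hm, hm'⟩ := this.exists_finiteMaxWord hg
      exact ⟨m, hm, hm'.trans hv'⟩

theorem outdeg_eq_two_iff (hg : IsGentleRel Q rel) {v : Q.V} :
    outdeg Q v = 2 ↔ ∃ a b, a ≠ b ∧ Q.src a = v ∧ Q.src b = v := by
  have h : outdeg Q v = 2 ↔ 1 < outdeg Q v := by
    have := hg.outdeg_le v
    omega
  rw [h, outdeg, Finset.one_lt_card]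
  simp only [Finset.mem_filter, Finset.mem_univ, true_and]
  constructor
  · rintro ⟨a, ha, b, hb, hab⟩
    exact ⟨a, b, hab, ha, hb⟩
  · rintro ⟨a, b, hab, ha, hb⟩
    exact ⟨a, ha, b, hb, hab⟩

end Words

section ProjMod

variable {S : Type} [Ring S] {I J K : Type}

/-- The right module `⨁ᵢ eᵢ S`, as a submodule of the free module `S^I`. -/
def projMod (e : I → S) : Submodule Sᵐᵒᵖ (I → S) where
  carrier := {f | ∀ i, e i * f i = f i}
  add_mem' hf hg i := by rw [Pi.add_apply, mul_add, hf i, hg i]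
  zero_mem' i := by simp
  smul_mem' s f hf i := by
    rw [Pi.smul_apply, MulOpposite.smul_eq_mul_unop, ← mul_assoc, hf i]

theorem projMod_apply {e : I → S} (f : projMod e) (i : I) : e i * f.1 i = f.1 i := f.2 i

theorem free_right : Module.Free Sᵐᵒᵖ S :=
  Module.Free.of_equiv
    ({ toFun := MulOpposite.unop, invFun := MulOpposite.op, map_add' := fun _ _ => rfl,
       map_smul' := fun _ _ => rfl, left_inv := fun _ => rfl, right_inv := fun _ => rfl } :
      Sᵐᵒᵖ ≃ₗ[Sᵐᵒᵖ] S)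

theorem projective_projMod [Finite I] {e : I → S} (he : ∀ i, e i * e i = e i) :
    Module.Projective Sᵐᵒᵖ (projMod e) := by
  have := free_right (S := S)
  let p : (I → S) →ₗ[Sᵐᵒᵖ] projMod e :=
    { toFun := fun f => ⟨fun i => e i * f i, fun i => by rw [← mul_assoc, he]⟩
      map_add' := fun f g => Subtype.ext (funext fun i => mul_add _ _ _)
      map_smul' := fun s f => Subtype.ext (funext fun i => (mul_assoc _ _ _).symm) }
  exact Module.Projective.of_split (projMod e).subtype p
    (LinearMap.ext fun f => Subtype.ext (funext f.2))

/-- The element `eᵢ` of the `i`-th summand. -/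
def projGen [DecidableEq I] (e : I → S) (he : ∀ i, e i * e i = e i) (i : I) : projMod e :=
  ⟨Pi.single i (e i), fun j => by
    rcases eq_or_ne j i with rfl | h
    · simp [he]
    · simp [h]⟩

variable [Fintype J]

/-- The homomorphism `⨁ⱼ eⱼ S → ⨁ᵢ e'ᵢ S` given by a matrix. -/
def matHom (e : J → S) (e' : I → S) (M : I → J → S) (hM : ∀ i j, e' i * M i j = M i j) :
    projMod e →ₗ[Sᵐᵒᵖ] projMod e' where
  toFun f := ⟨fun i => ∑ j, M i j * f.1 j, fun i => by
    simp only [Finset.mul_sum, ← mul_assoc, hM]⟩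
  map_add' f g := Subtype.ext <| funext fun i => by simp [mul_add, Finset.sum_add_distrib]
  map_smul' s f := Subtype.ext <| funext fun i => by simp [Finset.sum_mul, mul_assoc]

theorem matHom_apply {e : J → S} {e' : I → S} {M : I → J → S} (hM : ∀ i j, e' i * M i j = M i j)
    (f : projMod e) (i : I) : (matHom e e' M hM f).1 i = ∑ j, M i j * f.1 j := rfl

variable [Fintype I] [Fintype K]

/-- The homomorphism `⨁ᵢ eᵢ S → S` given by a row vector. -/
def rowHom (e y : I → S) : projMod e →ₗ[Sᵐᵒᵖ] S where
  toFun f := ∑ i, y i * f.1 i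
  map_add' f g := by simp [mul_add, Finset.sum_add_distrib]
  map_smul' s f := by simp [Finset.sum_mul, mul_assoc]

theorem rowHom_apply (e y : I → S) (f : projMod e) : rowHom e y f = ∑ i, y i * f.1 i := rfl

theorem rowHom_projGen [DecidableEq I] {e : I → S} (he : ∀ i, e i * e i = e i) {y : I → S}
    (hy : ∀ i, y i * e i = y i) (i : I) : rowHom e y (projGen e he i) = y i := by
  rw [rowHom_apply, Finset.sum_eq_single i]
  · simp [projGen, hy]
  · intro j _ h
    simp [projGen, h]
  · simp

theorem rowHom_inj {e : I → S} (he : ∀ i, e i * e i = e i) {y z : I → S}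
    (hy : ∀ i, y i * e i = y i) (hz : ∀ i, z i * e i = z i) :
    rowHom e y = rowHom e z ↔ y = z := by
  classical
  refine ⟨fun h => funext fun i => ?_, fun h => h ▸ rfl⟩
  rw [← rowHom_projGen he hy, h, rowHom_projGen he hz]

theorem exists_rowHom {e : I → S} (he : ∀ i, e i * e i = e i) (φ : projMod e →ₗ[Sᵐᵒᵖ] S) :
    ∃ y : I → S, (∀ i, y i * e i = y i) ∧ φ = rowHom e y := by
  classical
  refine ⟨fun i => φ (projGen e he i), fun i => ?_, LinearMap.ext fun f => ?_⟩
  · have h : MulOpposite.op (e i) • projGen e he i = projGen e he i := by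
      refine Subtype.ext (funext fun j => ?_)
      rcases eq_or_ne j i with rfl | h
      · simp [projGen, he]
      · simp [projGen, h]
    beta_reduce
    conv_rhs => rw [← h, map_smul]
    rfl
  · have h : f = ∑ i, MulOpposite.op (f.1 i) • projGen e he i := by
      refine Subtype.ext (funext fun j => ?_)
      rw [Submodule.coe_sum, Finset.sum_apply, Finset.sum_eq_single j]
      · simp [projGen, projMod_apply]
      · intro i _ h
        simp [projGen, h.symm]
      · simp
    conv_lhs => rw [h, map_sum]
    simp [rowHom_apply, map_smul]

theorem rowHom_comp_matHom {e : J → S} {e' : I → S} {M : I → J → S}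
    (hM : ∀ i j, e' i * M i j = M i j) (y : I → S) :
    rowHom e' y ∘ₗ matHom e e' M hM = rowHom e fun j => ∑ i, y i * M i j := by
  refine LinearMap.ext fun f => ?_
  simp only [LinearMap.comp_apply, rowHom_apply, matHom_apply, Finset.mul_sum, Finset.sum_mul,
    mul_assoc]
  exact Finset.sum_comm

theorem exists_comp_eq_zero_ne_zero_iff {e : J → S} {e' : I → S} {M : I → J → S}
    (he : ∀ i, e i * e i = e i) (he' : ∀ i, e' i * e' i = e' i)
    (hM : ∀ i j, e' i * M i j = M i j) (hM' : ∀ i j, M i j * e j = M i j) :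
    (∃ φ : ModuleCat.of Sᵐᵒᵖ (projMod e') ⟶ ModuleCat.of Sᵐᵒᵖ S,
        ModuleCat.ofHom (matHom e e' M hM) ≫ φ = 0 ∧ φ ≠ 0) ↔
      ∃ y : I → S, (∀ i, y i * e' i = y i) ∧ (∀ j, ∑ i, y i * M i j = 0) ∧ y ≠ 0 := by
  have hMy (y : I → S) (j : J) : (∑ i, y i * M i j) * e j = ∑ i, y i * M i j := by
    simp only [Finset.sum_mul, mul_assoc, hM']
  have h0 (e : I → S) : rowHom e 0 = 0 := LinearMap.ext fun f => by simp [rowHom_apply]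
  have h0' : rowHom e 0 = 0 := LinearMap.ext fun f => by simp [rowHom_apply]
  constructor
  · rintro ⟨φ, hφ, hφ0⟩
    obtain ⟨y, hy, hφy⟩ := exists_rowHom he' φ.hom
    refine ⟨y, hy, fun j => ?_, ?_⟩
    · have := congrArg ModuleCat.Hom.hom hφ
      rw [ModuleCat.hom_comp, hφy, ModuleCat.hom_ofHom, rowHom_comp_matHom, ModuleCat.hom_zero,
        ← h0', rowHom_inj he (hMy y) (by simp)] at this
      exact congrFun this j
    · rintro rfl
      exact hφ0 (ModuleCat.hom_ext (hφy.trans (h0 _)))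
  · rintro ⟨y, hy, hyM, hy0⟩
    refine ⟨ModuleCat.ofHom (rowHom e' y), ModuleCat.hom_ext ?_, fun h => hy0 ?_⟩
    · rw [ModuleCat.hom_comp, ModuleCat.hom_ofHom, ModuleCat.hom_ofHom, rowHom_comp_matHom,
        ModuleCat.hom_zero, ← h0', rowHom_inj he (hMy y) (by simp)]
      exact funext hyM
    · have := congrArg ModuleCat.Hom.hom h
      rwa [ModuleCat.hom_ofHom, ModuleCat.hom_zero, ← h0, rowHom_inj he' hy (by simp)] at this

theorem exists_comp_eq_zero_not_comp_iff {e : K → S} {e' : J → S} {e'' : I → S}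
    {M : J → K → S} {M' : I → J → S} (he : ∀ i, e i * e i = e i) (he' : ∀ i, e' i * e' i = e' i)
    (he'' : ∀ i, e'' i * e'' i = e'' i) (hM : ∀ i j, e' i * M i j = M i j)
    (hMe : ∀ i j, M i j * e j = M i j)
    (hM' : ∀ i j, e'' i * M' i j = M' i j) (hMe' : ∀ i j, M' i j * e' j = M' i j) :
    (∃ φ : ModuleCat.of Sᵐᵒᵖ (projMod e') ⟶ ModuleCat.of Sᵐᵒᵖ S,
        ModuleCat.ofHom (matHom e e' M hM) ≫ φ = 0 ∧
        ∀ ψ : ModuleCat.of Sᵐᵒᵖ (projMod e'') ⟶ ModuleCat.of Sᵐᵒᵖ S,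
          ModuleCat.ofHom (matHom e' e'' M' hM') ≫ ψ ≠ φ) ↔
      ∃ y : J → S, (∀ i, y i * e' i = y i) ∧ (∀ j, ∑ i, y i * M i j = 0) ∧
        ∀ z : I → S, (∀ i, z i * e'' i = z i) → ∃ j, ∑ i, z i * M' i j ≠ y j := by
  have hMy (y : J → S) (j : K) : (∑ i, y i * M i j) * e j = ∑ i, y i * M i j := by
    simp only [Finset.sum_mul, mul_assoc, hMe]
  have hMy' (y : I → S) (j : J) : (∑ i, y i * M' i j) * e' j = ∑ i, y i * M' i j := by
    simp only [Finset.sum_mul, mul_assoc, hMe']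
  have h0 : rowHom e 0 = 0 := LinearMap.ext fun f => by simp [rowHom_apply]
  constructor
  · rintro ⟨φ, hφ, hφ0⟩
    obtain ⟨y, hy, hφy⟩ := exists_rowHom he' φ.hom
    refine ⟨y, hy, fun j => ?_, fun z hz => ?_⟩
    · have := congrArg ModuleCat.Hom.hom hφ
      rw [ModuleCat.hom_comp, hφy, ModuleCat.hom_ofHom, rowHom_comp_matHom, ModuleCat.hom_zero,
        ← h0, rowHom_inj he (hMy y) (by simp)] at this
      exact congrFun this j
    · by_contra! h
      refine hφ0 (ModuleCat.ofHom (rowHom e'' z)) (ModuleCat.hom_ext ?_)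
      rw [ModuleCat.hom_comp, hφy, ModuleCat.hom_ofHom, ModuleCat.hom_ofHom, rowHom_comp_matHom,
        rowHom_inj he' (hMy' z) hy]
      exact funext h
  · rintro ⟨y, hy, hyM, hy0⟩
    refine ⟨ModuleCat.ofHom (rowHom e' y), ModuleCat.hom_ext ?_, fun ψ h => ?_⟩
    · rw [ModuleCat.hom_comp, ModuleCat.hom_ofHom, ModuleCat.hom_ofHom, rowHom_comp_matHom,
        ModuleCat.hom_zero, ← h0, rowHom_inj he (hMy y) (by simp)]
      exact funext hyM
    · obtain ⟨z, hz, hψz⟩ := exists_rowHom he'' ψ.hom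
      obtain ⟨j, hj⟩ := hy0 z hz
      have := congrArg ModuleCat.Hom.hom h
      rw [ModuleCat.hom_comp, hψz, ModuleCat.hom_ofHom, ModuleCat.hom_ofHom, rowHom_comp_matHom,
        rowHom_inj he' (hMy' z) hy] at this
      exact hj (congrFun this j)

end ProjMod

section Resolution

variable (k : Type) [Field k] {Q : Quiv} (rel : Q.Arr → Q.Arr → Prop)

/-- The element of `A` given by an optional arrow. -/
def optArr : Option Q.Arr → GA k Q rel := fun o => o.elim 0 (arr k Q rel)

/-- The stationary path at the target of an optional arrow. -/
def optTgt : Option Q.Arr → GA k Q rel := fun o => o.elim 0 fun a => vtx k Q rel (Q.tgt a)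

variable {k rel}

theorem optTgt_mul_self (o : Option Q.Arr) : optTgt k rel o * optTgt k rel o = optTgt k rel o := by
  cases o with
  | none => exact zero_mul _
  | some a => exact vtx_mul_self _

theorem optArr_mul_optTgt (o : Option Q.Arr) : optArr k rel o * optTgt k rel o =
    optArr k rel o := by
  cases o with
  | none => exact zero_mul _
  | some a => exact arr_mul_vtx_tgt _

theorem vtxHom_optArr (v : Q.V) (o : Option Q.Arr) : vtxHom k Q rel v (optArr k rel o) = 0 := by
  cases o with
  | none => exact map_zero _
  | some a => exact vtxHom_arr v a

theorem vtx_mul_optArr_zero (v : Q.V) (a : Q.Arr) :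
    vtx k Q rel v * optArr k rel (nthArr rel v 0 a) = optArr k rel (nthArr rel v 0 a) := by
  rw [nthArr]
  split_ifs with h
  · subst h
    exact vtx_src_mul_arr a
  · exact mul_zero _

theorem optTgt_mul_optArr_succ (hg : IsGentleRel Q rel) (v : Q.V) (n : ℕ) (a : Q.Arr) :
    optTgt k rel (nthArr rel v n a) * optArr k rel (nthArr rel v (n + 1) a) =
      optArr k rel (nthArr rel v (n + 1) a) := by
  rcases h : nthArr rel v (n + 1) a with - | b
  · exact mul_zero _
  · obtain ⟨c, hc, hcb⟩ := (nthArr_succ_eq_some hg).1 h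
    rw [hc]
    change vtx k Q rel _ * arr k Q rel b = arr k Q rel b
    rw [hg.rel_comp _ _ hcb, vtx_src_mul_arr]

theorem optArr_mul_optArr_succ (hg : IsGentleRel Q rel) (v : Q.V) (n : ℕ) (a : Q.Arr) :
    optArr k rel (nthArr rel v n a) * optArr k rel (nthArr rel v (n + 1) a) = 0 := by
  rcases h : nthArr rel v (n + 1) a with - | b
  · exact mul_zero _
  · obtain ⟨c, hc, hcb⟩ := (nthArr_succ_eq_some hg).1 h
    rw [hc]
    exact arr_mul_arr_of_rel hcb

theorem exists_optArr_mul_eq (hg : IsGentleRel Q rel) {v : Q.V} {n : ℕ} {a : Q.Arr}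
    {x : GA k Q rel} (hx : optTgt k rel (nthArr rel v n a) * x = x)
    (h : optArr k rel (nthArr rel v n a) * x = 0) :
    ∃ y, optTgt k rel (nthArr rel v (n + 1) a) * y = y ∧
      optArr k rel (nthArr rel v (n + 1) a) * y = x := by
  suffices ∃ y, optArr k rel (nthArr rel v (n + 1) a) * y = x by
    obtain ⟨y, hy⟩ := this
    refine ⟨optTgt k rel (nthArr rel v (n + 1) a) * y, ?_, ?_⟩
    · rw [← mul_assoc, optTgt_mul_self]
    · rw [← mul_assoc, optArr_mul_optTgt, hy]
  rcases hc : nthArr rel v n a with - | c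
  · rw [hc] at hx
    exact ⟨0, (mul_zero _).trans ((zero_mul x).symm.trans hx)⟩
  · rw [hc] at hx h
    have hmem : x ∈ LinearMap.range (LinearMap.mulLeft k (optArr k rel (nthArr rel v (n + 1) a))) := by
      refine mem_of_arr_mul_eq_zero hx h fun d hd y => ⟨y, ?_⟩
      rw [(nthArr_succ_eq_some hg).2 ⟨c, hc, hd⟩]
      rfl
    exact hmem

theorem optArr_zero_mul_eq_zero {v : Q.V} {f : Q.Arr → GA k Q rel}
    (h : ∑ a, optArr k rel (nthArr rel v 0 a) * f a = 0) (a : Q.Arr) :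
    optArr k rel (nthArr rel v 0 a) * f a = 0 := by
  have h' (a : Q.Arr) : optArr k rel (nthArr rel v 0 a) * f a =
      arr k Q rel a * if Q.src a = v then f a else 0 := by
    rw [nthArr]
    split_ifs
    · rfl
    · exact (zero_mul _).trans (mul_zero _).symm
  simp only [h'] at h ⊢
  exact arr_mul_eq_zero_of_sum h a

theorem exists_sum_optArr_mul_eq {v : Q.V} {x : GA k Q rel} (hx : vtx k Q rel v * x = x)
    (h : vtxHom k Q rel v x = 0) :
    ∃ f : Q.Arr → GA k Q rel, (∀ a, optTgt k rel (nthArr rel v 0 a) * f a = f a) ∧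
      ∑ a, optArr k rel (nthArr rel v 0 a) * f a = x := by
  suffices x ∈ ⨆ a, LinearMap.range (LinearMap.mulLeft k (optArr k rel (nthArr rel v 0 a))) by
    obtain ⟨g, hg⟩ := (Submodule.mem_iSup_iff_exists_finsupp _ _).1 this
    choose f hf using hg.1
    refine ⟨fun a => optTgt k rel (nthArr rel v 0 a) * f a, fun a => ?_, ?_⟩
    · rw [← mul_assoc, optTgt_mul_self]
    · simp only [← mul_assoc, optArr_mul_optTgt]
      rw [← hg.2, Finsupp.sum_fintype _ _ fun _ => rfl]
      exact Finset.sum_congr rfl fun a _ => hf a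
  refine mem_of_vtxHom_eq_zero hx h fun a ha y => Submodule.mem_iSup_of_mem a ⟨y, ?_⟩
  rw [nthArr, if_pos ha]
  rfl

variable (k rel) in
/-- The terms of the minimal projective resolution of `S(v)`. -/
def resX (v : Q.V) : ℕ → ModuleCat (GA k Q rel)ᵐᵒᵖ
  | 0 => ModuleCat.of _ (projMod fun _ : Unit => vtx k Q rel v)
  | n + 1 => ModuleCat.of _ (projMod fun a => optTgt k rel (nthArr rel v n a))

/-- The differentials of the minimal projective resolution of `S(v)`. -/
def resD (hg : IsGentleRel Q rel) (v : Q.V) : ∀ n, resX k rel v (n + 1) ⟶ resX k rel v n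
  | 0 => ModuleCat.ofHom <| matHom _ _ (fun _ a => optArr k rel (nthArr rel v 0 a))
      fun _ a => vtx_mul_optArr_zero v a
  | n + 1 => ModuleCat.ofHom <| matHom _ _
      (Matrix.diagonal fun a => optArr k rel (nthArr rel v (n + 1) a)) fun a b => by
        rcases eq_or_ne a b with rfl | h
        · rw [Matrix.diagonal_apply_eq, optTgt_mul_optArr_succ hg]
        · rw [Matrix.diagonal_apply_ne _ h, mul_zero]

theorem resD_zero_apply (hg : IsGentleRel Q rel) (v : Q.V) (f : resX k rel v 1) (i : Unit) :
    (resD hg v 0 f).1 i = ∑ a, optArr k rel (nthArr rel v 0 a) * f.1 a := rfl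

theorem resD_succ_apply (hg : IsGentleRel Q rel) (v : Q.V) (n : ℕ) (f : resX k rel v (n + 2))
    (a : Q.Arr) :
    (resD hg v (n + 1) f).1 a = optArr k rel (nthArr rel v (n + 1) a) * f.1 a := by
  change ∑ b, Matrix.diagonal _ a b * f.1 b = _
  rw [Finset.sum_eq_single a]
  · rw [Matrix.diagonal_apply_eq]
  · intro b _ h
    rw [Matrix.diagonal_apply_ne _ h.symm, zero_mul]
  · simp

variable (k rel) in
/-- The augmentation of the minimal projective resolution of `S(v)`. -/
def resAug (v : Q.V) : resX k rel v 0 ⟶ SvModR k Q rel v :=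
  @ModuleCat.ofHom _ _ _ k _ _ _
    (Module.compHom k ((vtxHom k Q rel v).fromOpposite (fun _ _ => mul_comm _ _)))
    (@LinearMap.mk _ _ _ _ (RingHom.id _) (projMod fun _ : Unit => vtx k Q rel v) k _ _ _
      (Module.compHom k ((vtxHom k Q rel v).fromOpposite (fun _ _ => mul_comm _ _)))
      ⟨fun f => vtxHom k Q rel v (f.1 ()), fun _ _ => map_add _ _ _⟩
      fun s f => (map_mul (vtxHom k Q rel v) (f.1 ()) s.unop).trans (mul_comm _ _))

theorem resAug_apply (v : Q.V) (f : resX k rel v 0) :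
    resAug k rel v f = vtxHom k Q rel v (f.1 ()) := rfl

theorem resD_comp_resD (hg : IsGentleRel Q rel) (v : Q.V) (n : ℕ) :
    resD (k := k) hg v (n + 1) ≫ resD hg v n = 0 := by
  refine ModuleCat.hom_ext (LinearMap.ext fun f => ?_)
  cases n with
  | zero =>
    refine Subtype.ext (funext fun i => ?_)
    refine (resD_zero_apply hg v (resD hg v 1 f) i).trans (Finset.sum_eq_zero fun a _ => ?_)
    rw [resD_succ_apply, ← mul_assoc, optArr_mul_optArr_succ hg, zero_mul]
  | succ n =>
    refine Subtype.ext (funext fun a => ?_)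
    refine (resD_succ_apply hg v n (resD hg v (n + 2) f) a).trans ?_
    rw [resD_succ_apply, ← mul_assoc, optArr_mul_optArr_succ hg, zero_mul]
    rfl

theorem resD_comp_resAug (hg : IsGentleRel Q rel) (v : Q.V) :
    resD (k := k) hg v 0 ≫ resAug k rel v = 0 := by
  refine ModuleCat.hom_ext (LinearMap.ext fun f => ?_)
  refine (resAug_apply v (resD hg v 0 f)).trans ?_
  rw [resD_zero_apply, map_sum]
  refine Finset.sum_eq_zero fun a _ => ?_
  rw [map_mul]
  exact mul_eq_zero_of_left (M₀ := k) (vtxHom_optArr v _) _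

instance projective_resX (v : Q.V) (n : ℕ) : Projective (resX k rel v n) := by
  cases n with
  | zero =>
    exact (IsProjective.iff_projective _).1 (projective_projMod fun _ => vtx_mul_self v)
  | succ n =>
    exact (IsProjective.iff_projective _).1 (projective_projMod fun _ => optTgt_mul_self _)

theorem resAug_surjective (v : Q.V) : Function.Surjective (resAug k rel v) := by
  intro (c : k)
  refine ⟨⟨fun _ => vtx k Q rel v * algebraMap k _ c, fun _ => ?_⟩, ?_⟩
  · rw [← mul_assoc, vtx_mul_self]
  · refine (resAug_apply v _).trans ?_
    rw [map_mul, vtxHom_vtx, vtxHom_algebraMap, if_pos rfl, one_mul]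

theorem exists_resD_zero_eq (hg : IsGentleRel Q rel) {v : Q.V} (x : resX k rel v 0)
    (h : resAug k rel v x = 0) : ∃ y, resD hg v 0 y = x := by
  obtain ⟨f, hf, hfx⟩ := exists_sum_optArr_mul_eq (x.2 ()) ((resAug_apply v x).symm.trans h)
  exact ⟨⟨f, hf⟩, Subtype.ext (funext fun i => hfx)⟩

theorem exists_resD_succ_eq (hg : IsGentleRel Q rel) {v : Q.V} (n : ℕ) (x : resX k rel v (n + 1))
    (h : resD hg v n x = 0) : ∃ y, resD hg v (n + 1) y = x := by
  have h' (a : Q.Arr) : optArr k rel (nthArr rel v n a) * x.1 a = 0 := by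
    cases n with
    | zero =>
      exact optArr_zero_mul_eq_zero ((resD_zero_apply hg v x ()).symm.trans
        (congrFun (congrArg Subtype.val h) ())) a
    | succ n =>
      exact (resD_succ_apply hg v n x a).symm.trans (congrFun (congrArg Subtype.val h) a)
  choose y hy hyx using fun a => exists_optArr_mul_eq hg (x.2 a) (h' a)
  exact ⟨⟨y, hy⟩, Subtype.ext (funext fun a =>
    (resD_succ_apply hg v n ⟨y, hy⟩ a).trans (hyx a))⟩

end Resolution

section Ext

variable {k : Type} [Field k] {Q : Quiv} {rel : Q.Arr → Q.Arr → Prop}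

theorem extSvNZ_zero_iff (hg : IsGentleRel Q rel) (v : Q.V) :
    extSvNZ k Q rel 0 v ↔ ∃ y : GA k Q rel, y ≠ 0 ∧ y * vtx k Q rel v = y ∧
      ∀ a, Q.src a = v → y * arr k Q rel a = 0 := by
  refine (extNZ_zero_iff_of_exact (resX k rel v) (resD hg v) (resD_comp_resD hg v)
    (resAug k rel v) (resD_comp_resAug hg v) (resAug_surjective v) (exists_resD_zero_eq hg)
    (exists_resD_succ_eq hg) (AModR k Q rel)).trans ?_
  refine (exists_comp_eq_zero_ne_zero_iff (fun _ => optTgt_mul_self _) (fun _ => vtx_mul_self v)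
    (fun _ a => vtx_mul_optArr_zero v a) fun _ _ => optArr_mul_optTgt _).trans ?_
  simp only [Finset.univ_unique, Finset.sum_singleton]
  constructor
  · rintro ⟨y, hy, hya, hy0⟩
    refine ⟨y (), fun h => hy0 (funext fun _ => h), hy (), fun a ha => ?_⟩
    have := hya a
    rwa [nthArr, if_pos ha] at this
  · rintro ⟨y, hy0, hy, hya⟩
    refine ⟨fun _ => y, fun _ => hy, fun a => ?_, fun h => hy0 (congrFun h ())⟩
    rw [nthArr]
    split_ifs with h
    · exact hya a h
    · exact mul_zero _

theorem extSvNZ_one_iff_exists (hg : IsGentleRel Q rel) (v : Q.V) :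
    extSvNZ k Q rel 1 v ↔ ∃ y : Q.Arr → GA k Q rel,
      (∀ a, y a * optTgt k rel (nthArr rel v 0 a) = y a) ∧
      (∀ a, y a * optArr k rel (nthArr rel v 1 a) = 0) ∧
      ∀ z, z * vtx k Q rel v = z → ∃ a, z * optArr k rel (nthArr rel v 0 a) ≠ y a := by
  refine (extNZ_succ_iff_of_exact (resX k rel v) (resD hg v) (resD_comp_resD hg v)
    (resAug k rel v) (resD_comp_resAug hg v) (resAug_surjective v) (exists_resD_zero_eq hg)
    (exists_resD_succ_eq hg) (AModR k Q rel) 0).trans ?_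
  refine (exists_comp_eq_zero_not_comp_iff (fun _ => optTgt_mul_self _)
    (fun _ => optTgt_mul_self _) (fun _ => vtx_mul_self v) _ (fun a b => ?_)
    (fun _ a => vtx_mul_optArr_zero v a) fun _ _ => optArr_mul_optTgt _).trans ?_
  · rcases eq_or_ne a b with rfl | h
    · rw [Matrix.diagonal_apply_eq, optArr_mul_optTgt]
    · rw [Matrix.diagonal_apply_ne _ h, zero_mul]
  · simp only [Finset.univ_unique, Finset.sum_singleton, Matrix.diagonal_apply, mul_ite, mul_zero,
      Finset.sum_ite_eq', Finset.mem_univ, if_true]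
    refine exists_congr fun y => and_congr_right fun _ => and_congr_right fun _ => ?_
    exact ⟨fun h z hz => h (fun _ => z) fun _ => hz, fun h z hz => h (z ()) (hz ())⟩

theorem extSvNZ_add_two_iff_exists (hg : IsGentleRel Q rel) (v : Q.V) (n : ℕ) :
    extSvNZ k Q rel (n + 2) v ↔ ∃ y : Q.Arr → GA k Q rel,
      (∀ a, y a * optTgt k rel (nthArr rel v (n + 1) a) = y a) ∧
      (∀ a, y a * optArr k rel (nthArr rel v (n + 2) a) = 0) ∧
      ∀ z : Q.Arr → GA k Q rel, (∀ a, z a * optTgt k rel (nthArr rel v n a) = z a) →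
        ∃ a, z a * optArr k rel (nthArr rel v (n + 1) a) ≠ y a := by
  refine (extNZ_succ_iff_of_exact (resX k rel v) (resD hg v) (resD_comp_resD hg v)
    (resAug k rel v) (resD_comp_resAug hg v) (resAug_surjective v) (exists_resD_zero_eq hg)
    (exists_resD_succ_eq hg) (AModR k Q rel) (n + 1)).trans ?_
  refine (exists_comp_eq_zero_not_comp_iff (fun _ => optTgt_mul_self _)
    (fun _ => optTgt_mul_self _) (fun _ => optTgt_mul_self _) _ (fun a b => ?_)
    _ (fun a b => ?_)).trans ?_
  · rcases eq_or_ne a b with rfl | h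
    · rw [Matrix.diagonal_apply_eq, optArr_mul_optTgt]
    · rw [Matrix.diagonal_apply_ne _ h, zero_mul]
  · rcases eq_or_ne a b with rfl | h
    · rw [Matrix.diagonal_apply_eq, optArr_mul_optTgt]
    · rw [Matrix.diagonal_apply_ne _ h, zero_mul]
  · simp only [Matrix.diagonal_apply, mul_ite, mul_zero,
      Finset.sum_ite_eq', Finset.mem_univ, if_true]

theorem exists_mul_arr_eq (hg : IsGentleRel Q rel) {c b : Q.Arr} (hcb : rel c b)
    {y : GA k Q rel} (hy : y * vtx k Q rel (Q.tgt c) = y) (h : y * arr k Q rel b = 0) :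
    ∃ z, z * vtx k Q rel (Q.src c) = z ∧ z * arr k Q rel c = y := by
  have hmem : y ∈ LinearMap.range (LinearMap.mulRight k (arr k Q rel c)) := by
    refine mem_of_mul_arr_eq_zero (hg.rel_comp _ _ hcb ▸ hy) h fun d hd x => ⟨x, ?_⟩
    rw [eq_of_rel_left hg hd hcb]
    rfl
  obtain ⟨z, rfl⟩ := hmem
  refine ⟨z * vtx k Q rel (Q.src c), ?_, ?_⟩
  · rw [mul_assoc, vtx_mul_self]
  · rw [mul_assoc, vtx_src_mul_arr]
    rfl

/-- The cocycle of `Ext^{n+1}(S(v), A)` attached to a right maximal forbidden path. -/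
theorem exists_cocycle_of_step_eq_none {v : Q.V} {n : ℕ} {a b : Q.Arr}
    (hb : nthArr rel v n a = some b) (hstep : step rel b = none) :
    ∃ y : Q.Arr → GA k Q rel, (∀ a, y a * optTgt k rel (nthArr rel v n a) = y a) ∧
      (∀ a, y a * optArr k rel (nthArr rel v (n + 1) a) = 0) ∧
      ∃ a, ∀ z, z * optArr k rel (nthArr rel v n a) ≠ y a := by
  refine ⟨Pi.single a (vtx k Q rel (Q.tgt b)), fun c => ?_, fun c => ?_, a, fun z h => ?_⟩
  · rcases eq_or_ne c a with rfl | h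
    · rw [Pi.single_eq_same, hb]
      exact vtx_mul_self _
    · rw [Pi.single_eq_of_ne h, zero_mul]
  · rcases eq_or_ne c a with rfl | h
    · rw [nthArr, hb, Option.bind_some, hstep]
      exact mul_zero _
    · rw [Pi.single_eq_of_ne h, zero_mul]
  · rw [Pi.single_eq_same, hb] at h
    exact vtx_ne_mul_arr _ _ _ h.symm

theorem extSvNZ_one_iff (hg : IsGentleRel Q rel) (v : Q.V) :
    extSvNZ k Q rel 1 v ↔ (∃ a b, a ≠ b ∧ Q.src a = v ∧ Q.src b = v) ∨
      ∃ a b, nthArr rel v 0 a = some b ∧ step rel b = none := by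
  rw [extSvNZ_one_iff_exists hg]
  constructor
  · rintro ⟨y, hy, hy', hz⟩
    by_contra! h
    obtain ⟨huniq, hstep⟩ := h
    suffices ∃ z, z * vtx k Q rel v = z ∧ ∀ a, Q.src a = v → z * arr k Q rel a = y a by
      obtain ⟨z, hzv, hza⟩ := this
      obtain ⟨a, ha⟩ := hz z hzv
      have hya := hy a
      rw [nthArr] at ha hya
      split_ifs at ha hya with hav
      · exact ha (hza a hav)
      · exact ha ((mul_zero z).trans ((mul_zero (y a)).symm.trans hya))
    by_cases hsrc : ∃ a, Q.src a = v
    · obtain ⟨a, ha⟩ := hsrc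
      have ha0 : nthArr rel v 0 a = some a := nthArr_zero_eq_some.2 ⟨ha, rfl⟩
      obtain ⟨b, hb⟩ := Option.ne_none_iff_exists'.1 (hstep a a ha0)
      have hya := hy a
      have hya' := hy' a
      rw [nthArr, ha0, Option.bind_some, hb] at hya'
      rw [ha0] at hya
      obtain ⟨z, hzv, hza⟩ := exists_mul_arr_eq hg ((step_eq_some hg).1 hb) hya hya'
      refine ⟨z, ha ▸ hzv, fun c hc => ?_⟩
      obtain rfl : a = c := by
        by_contra hac
        exact huniq a c hac ha hc
      exact hza
    · exact ⟨0, zero_mul _, fun a ha => absurd ⟨a, ha⟩ hsrc⟩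
  · rintro (⟨a, b, hab, ha, hb⟩ | ⟨a, b, hb, hstep⟩)
    · have h0 (c : Q.Arr) (hc : Q.src c = v) : nthArr rel v 0 c = some c :=
        nthArr_zero_eq_some.2 ⟨hc, rfl⟩
      refine ⟨Pi.single a (arr k Q rel a), fun c => ?_, fun c => ?_, fun z _ => ?_⟩
      · rcases eq_or_ne c a with rfl | h
        · rw [Pi.single_eq_same, h0 c ha]
          exact arr_mul_vtx_tgt _
        · rw [Pi.single_eq_of_ne h, zero_mul]
      · rcases eq_or_ne c a with rfl | h
        · have := optArr_mul_optArr_succ (k := k) hg v 0 c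
          rw [h0 c ha] at this
          rw [Pi.single_eq_same]
          exact this
        · rw [Pi.single_eq_of_ne h, zero_mul]
      · by_contra! h
        have h1 := h a
        have h2 := h b
        rw [h0 a ha, Pi.single_eq_same] at h1
        rw [h0 b hb, Pi.single_eq_of_ne hab.symm] at h2
        exact mul_arr_ne_zero_of_mul_arr_eq (ha.trans hb.symm) h1 h2
    · obtain ⟨y, hy, hy', c, hc⟩ := exists_cocycle_of_step_eq_none (k := k) hb hstep
      exact ⟨y, hy, hy', fun z _ => ⟨c, hc z⟩⟩

theorem extSvNZ_add_two_iff (hg : IsGentleRel Q rel) (v : Q.V) (n : ℕ) :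
    extSvNZ k Q rel (n + 2) v ↔
      ∃ a b, nthArr rel v (n + 1) a = some b ∧ step rel b = none := by
  rw [extSvNZ_add_two_iff_exists hg]
  constructor
  · rintro ⟨y, hy, hy', hz⟩
    by_contra! hstep
    have (a : Q.Arr) : ∃ z, z * optTgt k rel (nthArr rel v n a) = z ∧
        z * optArr k rel (nthArr rel v (n + 1) a) = y a := by
      have hya := hy a
      have hya' := hy' a
      rcases hc : nthArr rel v (n + 1) a with - | c
      · rw [hc] at hya
        exact ⟨0, zero_mul _, (zero_mul _).trans ((mul_zero (y a)).symm.trans hya)⟩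
      · obtain ⟨b, hb⟩ := Option.ne_none_iff_exists'.1 (hstep a c hc)
        obtain ⟨d, hd, hdc⟩ := (nthArr_succ_eq_some hg).1 hc
        rw [nthArr, hc, Option.bind_some, hb] at hya'
        rw [hc] at hya
        obtain ⟨z, hzv, hza⟩ := exists_mul_arr_eq hg ((step_eq_some hg).1 hb) hya hya'
        refine ⟨z, ?_, hza⟩
        rw [hd]
        rwa [← hg.rel_comp _ _ hdc] at hzv
    choose z hz1 hz2 using this
    obtain ⟨a, ha⟩ := hz z hz1
    exact ha (hz2 a)
  · rintro ⟨a, b, hb, hstep⟩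
    obtain ⟨y, hy, hy', c, hc⟩ := exists_cocycle_of_step_eq_none (k := k) hb hstep
    exact ⟨y, hy, hy', fun z _ => ⟨c, hc (z c)⟩⟩

end Ext

end LocGentle

namespace LocGentle

/-- **Corollary 4.9 (cor:extcalc).** Let `A = kQ/I` be a (locally) gentle algebra and
`v ∈ Q₀`.  Then `grExt^i_A(S(v), A) ≠ 0` if and only if one of the following holds:
(1) `i = 0` and there is a finite maximal path of `A` with target `v`;
(2) `i = 1` and there are two arrows with source `v`;
(3) `i > 0` and there is a right maximal forbidden path of length `i` with source `v`. -/
theorem statement12 (k : Type) [Field k] [CharZero k] (Q : Quiv)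
    (rel : Q.Arr → Q.Arr → Prop) (hgentle : IsGentleRel Q rel) (v : Q.V) :
    ∀ i : ℕ, extSvNZ k Q rel i v ↔
      ((i = 0 ∧ ∃ l : List Q.Arr, FiniteMaxWord rel l ∧ wTgt? l = some v) ∨
       (i = 1 ∧ outdeg Q v = 2) ∨
       (0 < i ∧ ∃ l : List Q.Arr, RightMaxWord (dualRel rel) l ∧ l.length = i ∧
          wSrc? l = some v)) := by
  intro i
  rcases i with - | - | n
  · rw [extSvNZ_zero_iff hgentle, ← exists_finiteMaxWord_iff k hgentle]
    simp
  · rw [extSvNZ_one_iff hgentle, ← outdeg_eq_two_iff hgentle,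
      ← exists_rightMaxWord_dualRel_iff hgentle]
    simp
  · rw [extSvNZ_add_two_iff hgentle, ← exists_rightMaxWord_dualRel_iff hgentle]
    simp

end LocGentle
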